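/- arXiv:1709.05904 — 9 statements merged into one kernel-verified Lean document; each statement's English description precedes it below -/
import Mathlib

section
/- For every integer k ≥ 1 there exists a finite tree T such that the bush number satisfies B(T) > k, i.e., k bush-cutters cannot remove the bush from T. (Such a tree can be obtained from the complete (12k+1)-ary rooted tree of height 6k by subdividing every edge twice.) -/
noncomputable section

open SimpleGraph

/-- The closed neighborhood `N[A]` of a set `A` of vertices of a graph. -/
def closedNbhd {V : Type*} (G : SimpleGraph V) (A : Set V) : Set V :=
  {x | ∃ a ∈ A, a = x ∨ G.Adj a x}

/-- A robber walk: at every time step the robber stays put or moves to an adjacent vertex. -/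
def IsRobberWalk {V : Type*} (G : SimpleGraph V) (w : ℕ → V) : Prop :=
  ∀ t, w (t + 1) = w t ∨ G.Adj (w t) (w (t + 1))
/-- The set of vertices carrying a bush just before round `t + 1` of the bush game,
when the cutters cut the closed neighborhood of `S t` at round `t + 1`:
initially every vertex carries a bush, and after each cut the remaining bush regrows
to its closed neighborhood. -/
def bushSet {V : Type*} (G : SimpleGraph V) (S : ℕ → Finset V) : ℕ → Set V
  | 0 => Set.univ
  | t + 1 => closedNbhd G (bushSet G S t \ closedNbhd G (↑(S t) : Set V))

/-- `k` bush-cutters win the bush game on `G`: some sequence of cut sets, each of at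
most `k` vertices, removes the bush completely at some round. -/
def BushGameWin {V : Type*} (G : SimpleGraph V) (k : ℕ) : Prop :=
  ∃ S : ℕ → Finset V, (∀ t, (S t).card ≤ k) ∧
    ∃ t, bushSet G S t \ closedNbhd G (↑(S t) : Set V) = ∅

/-- The bush number `B(G)`: the least number of bush-cutters that can remove the bush. -/
def bushNumber {V : Type*} (G : SimpleGraph V) : ℕ :=
  sInf {k | BushGameWin G k}

open Finset in
open scoped Pointwise in
theorem sum_mem_nsmul_aux (U : Finset ℤ) (h0 : (0 : ℤ) ∈ U) {ι : Type*} [DecidableEq ι]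
    (g : ι → ℤ) (E : ℕ) : ∀ (F : Finset ι), F.card ≤ E → (∀ i ∈ F, g i ∈ U) →
      ∑ i ∈ F, g i ∈ E • U := by
  induction E with
  | zero =>
    intro F hF _
    have : F = ∅ := by simpa using hF
    subst this
    simp
  | succ E ih =>
    intro F hF hg
    rw [succ_nsmul]
    rcases F.eq_empty_or_nonempty with rfl | ⟨a, ha⟩
    · have := ih ∅ (by simp) (by simp)
      have h2 := Finset.add_mem_add this h0
      simpa using h2
    · have h1 := ih (F.erase a) (by rw [Finset.card_erase_of_mem ha]; omega)
        (fun i hi => hg i (Finset.mem_of_mem_erase hi))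
      have h2 := Finset.add_mem_add h1 (hg a ha)
      rwa [Finset.sum_erase_add _ _ ha] at h2

/-- Size of the subtree below `v`. -/
def subSize (h v : ℕ) : ℤ := 2 ^ (h - Nat.log 2 v) - 1

theorem subSize_rec (h v : ℕ) (hv : 1 ≤ v) (hvh : v < 2 ^ h) :
    subSize h v = 1 + subSize h (2 * v) + subSize h (2 * v + 1) := by
  have h1 : Nat.log 2 (2 * v) = Nat.log 2 v + 1 := by
    rw [mul_comm]; exact Nat.log_mul_base (by norm_num) (by omega)
  have h2 : Nat.log 2 (2 * v + 1) = Nat.log 2 v + 1 := by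
    rw [Nat.log_of_one_lt_of_le (by norm_num) (by omega)]
    congr 2; omega
  have h3 : Nat.log 2 v < h := Nat.log_lt_of_lt_pow (by omega) hvh
  obtain ⟨d, hd⟩ : ∃ d, h = Nat.log 2 v + 1 + d := ⟨h - (Nat.log 2 v + 1), by omega⟩
  unfold subSize
  rw [h1, h2]
  have e1 : h - Nat.log 2 v = d + 1 := by omega
  have e2 : h - (Nat.log 2 v + 1) = d := by omega
  rw [e1, e2]; ring

theorem sum_range_two_mul_aux (f : ℕ → ℤ) (N : ℕ) :
    ∑ v ∈ Finset.range (2 * N), f v = ∑ u ∈ Finset.range N, (f (2 * u) + f (2 * u + 1)) := by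
  induction N with
  | zero => simp
  | succ N ih =>
    rw [show 2 * (N + 1) = 2 * N + 1 + 1 by ring, Finset.sum_range_succ, Finset.sum_range_succ,
      Finset.sum_range_succ, ih]; ring

theorem count_identity (h : ℕ) (c : ℕ → ℤ) :
    ∑ v ∈ Finset.range (2 ^ h), c v =
      c 0 * 2 ^ h + ∑ v ∈ Finset.range (2 ^ h), (c v - c (v / 2)) * subSize h v := by
  have hext : ∑ v ∈ Finset.range (2 ^ h), c (v / 2) * subSize h v =
      ∑ v ∈ Finset.range (2 * 2 ^ h), c (v / 2) * subSize h v := by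
    apply Finset.sum_subset
    · intro x hx; simp only [Finset.mem_range] at *; omega
    · intro x _ hx
      simp only [Finset.mem_range, not_lt] at hx
      have : h ≤ Nat.log 2 x := Nat.le_log_of_pow_le (by norm_num) hx
      simp [subSize, Nat.sub_eq_zero_of_le this]
  have hr : ∑ v ∈ Finset.range (2 ^ h), (c v - c (v / 2)) * subSize h v =
      ∑ u ∈ Finset.range (2 ^ h),
        c u * (subSize h u - subSize h (2 * u) - subSize h (2 * u + 1)) := by
    simp only [sub_mul]
    rw [Finset.sum_sub_distrib, hext, sum_range_two_mul_aux, ← Finset.sum_sub_distrib]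
    refine Finset.sum_congr rfl fun u _ => ?_
    have e1 : 2 * u / 2 = u := by omega
    have e2 : (2 * u + 1) / 2 = u := by omega
    rw [e1, e2]; ring
  rw [hr]
  obtain ⟨N, hN⟩ : ∃ N, 2 ^ h = N + 1 := ⟨2 ^ h - 1, by have := Nat.one_le_two_pow (n := h); omega⟩
  rw [hN, Finset.sum_range_succ', Finset.sum_range_succ' (n := N)]
  have : ∀ u ∈ Finset.range N, c (u + 1) *
      (subSize h (u + 1) - subSize h (2 * (u + 1)) - subSize h (2 * (u + 1) + 1)) = c (u + 1) := by
    intro u hu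
    rw [Finset.mem_range] at hu
    rw [subSize_rec h (u + 1) (by omega) (by omega)]; ring
  rw [Finset.sum_congr rfl this]
  simp [subSize]; ring

/-- The heap tree (parent of `v` is `v / 2`). -/
def heapTree (n : ℕ) : SimpleGraph (Fin n) where
  Adj a b := a ≠ b ∧ ((a : ℕ) = b / 2 ∨ (b : ℕ) = a / 2)
  symm := ⟨fun _ _ h => ⟨h.1.symm, h.2.symm⟩⟩
  loopless := ⟨fun _ h => h.1 rfl⟩

theorem heapTree_connected (n : ℕ) (hn : 0 < n) : (heapTree n).Connected := by
  have key : ∀ m : ℕ, ∀ hm : m < n, (heapTree n).Reachable ⟨m, hm⟩ ⟨0, hn⟩ := by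
    intro m
    induction m using Nat.strong_induction_on with
    | _ m ih =>
      intro hm
      rcases Nat.eq_zero_or_pos m with rfl | hpos
      · exact SimpleGraph.Reachable.refl _
      · have hlt : m / 2 < m := by omega
        refine SimpleGraph.Reachable.trans (SimpleGraph.Adj.reachable ?_)
          (ih (m / 2) hlt (by omega))
        refine ⟨?_, Or.inr rfl⟩
        intro h
        have := congrArg Fin.val h
        simp only at this
        omega
  have : Nonempty (Fin n) := ⟨⟨0, hn⟩⟩
  exact ⟨fun a b => (key a a.2).trans (key b b.2).symm⟩

theorem heapTree_acyclic (n : ℕ) (hn : 0 < n) : (heapTree n).IsAcyclic := by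
  classical
  have hc := heapTree_connected n hn
  have hle := hc.card_vert_le_card_edgeSet_add_one
  have hsub : (heapTree n).edgeSet ⊆
      (((Finset.univ.erase (⟨0, hn⟩ : Fin n)).image
        (fun v => s(v, (⟨(v : ℕ) / 2, by omega⟩ : Fin n))) : Finset (Sym2 (Fin n))) :
          Set (Sym2 (Fin n))) := by
    intro e
    induction e with
    | _ a b =>
      intro he
      rw [SimpleGraph.mem_edgeSet] at he
      obtain ⟨hne, h | h⟩ := he
      · simp only [Finset.coe_image, Set.mem_image, Finset.mem_coe, Finset.mem_erase,
          Finset.mem_univ, and_true]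
        refine ⟨b, ?_, ?_⟩
        · rintro rfl
          apply hne; apply Fin.ext; simpa using h
        · rw [Sym2.eq_swap]; congr 2; simp [h]
      · simp only [Finset.coe_image, Set.mem_image, Finset.mem_coe, Finset.mem_erase,
          Finset.mem_univ, and_true]
        refine ⟨a, ?_, ?_⟩
        · rintro rfl
          apply hne; apply Fin.ext; symm; simpa using h
        · congr 2; simp [h]
  have hcard : Nat.card (heapTree n).edgeSet ≤ n - 1 := by
    rw [Nat.card_coe_set_eq]
    refine (Set.ncard_le_ncard hsub (Finset.finite_toSet _)).trans ?_
    rw [Set.ncard_coe_finset]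
    refine Finset.card_image_le.trans ?_
    rw [Finset.card_erase_of_mem (Finset.mem_univ _)]; simp
  have ht : (heapTree n).IsTree := by
    rw [SimpleGraph.isTree_iff_connected_and_card]
    refine ⟨hc, ?_⟩
    simp only [Nat.card_eq_fintype_card, Fintype.card_fin] at hle hcard ⊢
    omega
  exact ht.isAcyclic

theorem ncard_closedNbhd_heap (n k : ℕ) (S : Finset (Fin n)) (hS : S.card ≤ k) :
    (closedNbhd (heapTree n) (S : Set (Fin n))).ncard ≤ 4 * k := by
  classical
  let f : Fin n → Finset ℕ := fun v => {(v : ℕ), (v : ℕ) / 2, 2 * (v : ℕ), 2 * (v : ℕ) + 1}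
  have h1 : (Fin.val '' (closedNbhd (heapTree n) (S : Set (Fin n)))) ⊆ (S.biUnion f : Set ℕ) := by
    rintro _ ⟨x, ⟨a, ha, h⟩, rfl⟩
    simp only [Finset.coe_biUnion, Set.mem_iUnion, Finset.mem_coe]
    refine ⟨a, ha, ?_⟩
    simp only [f, Finset.mem_insert, Finset.mem_singleton]
    rcases h with rfl | ⟨_, h | h⟩ <;> omega
  rw [← Set.ncard_image_of_injective _ Fin.val_injective]
  refine (Set.ncard_le_ncard h1 (Finset.finite_toSet _)).trans ?_
  rw [Set.ncard_coe_finset]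
  refine (Finset.card_biUnion_le_card_mul S f 4 ?_).trans (by omega)
  intro v _
  exact Finset.card_le_four

open scoped Pointwise in
/-- The set of possible single contributions. -/
def contrib (h : ℕ) : Finset ℤ :=
  insert (2 ^ h) ((Finset.range (h + 1)).image (fun j => (2 : ℤ) ^ j - 1) ∪
    (Finset.range (h + 1)).image (fun j => -((2 : ℤ) ^ j - 1)))

theorem card_contrib (h : ℕ) : (contrib h).card ≤ 2 * h + 3 := by
  unfold contrib
  refine (Finset.card_insert_le _ _).trans ?_
  have h1 := Finset.card_union_le ((Finset.range (h + 1)).image (fun j => (2 : ℤ) ^ j - 1))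
    ((Finset.range (h + 1)).image (fun j => -((2 : ℤ) ^ j - 1)))
  have h2 := Finset.card_image_le (s := Finset.range (h + 1)) (f := fun j => (2 : ℤ) ^ j - 1)
  have h3 := Finset.card_image_le (s := Finset.range (h + 1)) (f := fun j => -((2 : ℤ) ^ j - 1))
  rw [Finset.card_range] at h2 h3
  omega

theorem subset_closedNbhd {V : Type*} (G : SimpleGraph V) (A : Set V) : A ⊆ closedNbhd G A :=
  fun a ha => ⟨a, ha, Or.inl rfl⟩

theorem closedNbhd_mono {V : Type*} (G : SimpleGraph V) {A B : Set V} (h : A ⊆ B) :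
    closedNbhd G A ⊆ closedNbhd G B :=
  fun _ ⟨a, ha, hx⟩ => ⟨a, h ha, hx⟩

open scoped Pointwise in
theorem small_boundary (h b : ℕ) (Y : Set (Fin (2 ^ h)))
    (hY : (closedNbhd (heapTree (2 ^ h)) Y \ Y).ncard ≤ b) :
    (Y.ncard : ℤ) ∈ (3 * b + 1) • contrib h := by
  classical
  have hU0 : (0 : ℤ) ∈ contrib h := by
    unfold contrib
    simp only [Finset.mem_insert, Finset.mem_union, Finset.mem_image, Finset.mem_range]
    exact Or.inr (Or.inl ⟨0, by omega, by norm_num⟩)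
  let P : Set ℕ := Fin.val '' Y
  let c : ℕ → ℤ := fun v => if v ∈ P then 1 else 0
  have hcount : (Y.ncard : ℤ) = ∑ v ∈ Finset.range (2 ^ h), c v := by
    simp only [c]
    rw [Finset.sum_boole]
    congr 1
    rw [← Set.ncard_image_of_injective Y Fin.val_injective, ← Set.ncard_coe_finset]
    congr 1
    ext x
    simp only [Finset.coe_filter, Finset.mem_range, Set.mem_ofPred_eq, P]
    constructor
    · rintro hx
      refine ⟨?_, hx⟩
      obtain ⟨y, _, rfl⟩ := hx
      exact y.2
    · exact fun hx => hx.2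
  let D : Finset ℕ := (Set.toFinite (closedNbhd (heapTree (2 ^ h)) Y \ Y)).toFinset.image Fin.val
  have hD : D.card ≤ b := by
    refine Finset.card_image_le.trans ?_
    rwa [← Set.ncard_eq_toFinset_card]
  let F : Finset ℕ := (Finset.range (2 ^ h)).filter (fun v => c v ≠ c (v / 2))
  have hmemD : ∀ u v (hu : u < 2 ^ h) (hv : v < 2 ^ h), u ∈ P → v ∉ P → (u = v / 2 ∨ v = u / 2) →
      v ∈ D := by
    intro u v hu hv huP hvP hadj
    simp only [D, Finset.mem_image, Set.Finite.mem_toFinset]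
    obtain ⟨y, hy, rfl⟩ := huP
    refine ⟨⟨v, hv⟩, ⟨⟨y, hy, Or.inr ⟨?_, hadj⟩⟩, ?_⟩, rfl⟩
    · rintro rfl; exact hvP ⟨_, hy, rfl⟩
    · intro hv'; exact hvP ⟨_, hv', rfl⟩
  have hFsub : F ⊆ D ∪ (D.image (fun v => 2 * v) ∪ D.image (fun v => 2 * v + 1)) := by
    intro v hv
    simp only [F, Finset.mem_filter, Finset.mem_range] at hv
    obtain ⟨hv, hne⟩ := hv
    have hv2 : v / 2 < 2 ^ h := by omega
    simp only [Finset.mem_union, Finset.mem_image]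
    by_cases h1 : v ∈ P <;> by_cases h2 : v / 2 ∈ P
    · simp [c, h1, h2] at hne
    · have := hmemD v (v / 2) hv hv2 h1 h2 (Or.inr rfl)
      right
      rcases Nat.mod_two_eq_zero_or_one v with h3 | h3
      · exact Or.inl ⟨_, this, by omega⟩
      · exact Or.inr ⟨_, this, by omega⟩
    · exact Or.inl (hmemD (v / 2) v hv2 hv h2 h1 (Or.inl rfl))
    · simp [c, h1, h2] at hne
  have hF : F.card ≤ 3 * b := by
    refine (Finset.card_le_card hFsub).trans ?_
    have h1 := Finset.card_union_le D (D.image (fun v => 2 * v) ∪ D.image (fun v => 2 * v + 1))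
    have h2 := Finset.card_union_le (D.image (fun v => 2 * v)) (D.image (fun v => 2 * v + 1))
    have h3 := Finset.card_image_le (s := D) (f := fun v => 2 * v)
    have h4 := Finset.card_image_le (s := D) (f := fun v => 2 * v + 1)
    omega
  have hsum : ∑ v ∈ Finset.range (2 ^ h), (c v - c (v / 2)) * subSize h v =
      ∑ v ∈ F, (c v - c (v / 2)) * subSize h v := by
    symm
    apply Finset.sum_subset (Finset.filter_subset _ _)
    intro v hv hvF
    simp only [F, Finset.mem_filter, not_and, not_not] at hvF
    rw [hvF hv]; ring
  rw [hcount, count_identity, hsum, succ_nsmul,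
    add_comm (c 0 * 2 ^ h)]
  refine Finset.add_mem_add ?_ ?_
  · apply sum_mem_nsmul_aux _ hU0 _ _ _ hF
    intro v hv
    simp only [F, Finset.mem_filter, Finset.mem_range] at hv
    have hj : h - Nat.log 2 v < h + 1 := by omega
    unfold contrib
    simp only [Finset.mem_insert, Finset.mem_union, Finset.mem_image, Finset.mem_range]
    right
    obtain ⟨_, hne⟩ := hv
    by_cases h1 : v ∈ P <;> by_cases h2 : v / 2 ∈ P
    · simp [c, h1, h2] at hne
    · left; exact ⟨_, hj, by simp [c, h1, h2, subSize]⟩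
    · right; exact ⟨_, hj, by simp [c, h1, h2, subSize]⟩
    · simp [c, h1, h2] at hne
  · by_cases h0 : 0 ∈ P
    · simp [c, h0, contrib]
    · simpa [c, h0] using hU0

theorem exists_height (E : ℕ) : ∃ h : ℕ, (2 * h + 3) ^ E < 2 ^ h := by
  have ht := tendsto_pow_const_div_const_pow_of_one_lt E (r := (2 : ℝ)) (by norm_num)
  have hev := ht.eventually (gt_mem_nhds (show (0 : ℝ) < 1 / 5 ^ E by positivity))
  obtain ⟨h, h1, h2⟩ := (hev.and (Filter.eventually_ge_atTop 1)).exists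
  refine ⟨h, ?_⟩
  have h3 : (h : ℝ) ^ E * 5 ^ E < 2 ^ h := by
    rw [div_lt_div_iff₀ (by positivity) (by positivity)] at h1
    linarith
  have h4 : h ^ E * 5 ^ E < 2 ^ h := by exact_mod_cast h3
  calc (2 * h + 3) ^ E ≤ (h * 5) ^ E := Nat.pow_le_pow_left (by omega) E
    _ = h ^ E * 5 ^ E := by rw [mul_pow]
    _ < 2 ^ h := h4

open scoped Pointwise in
theorem exists_isoperimetric (b : ℕ) : ∃ h m : ℕ, m ≤ 2 ^ h ∧
    ∀ Y : Set (Fin (2 ^ h)), m ≤ Y.ncard →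
      m + b < (closedNbhd (heapTree (2 ^ h)) Y).ncard := by
  classical
  obtain ⟨h, hh⟩ := exists_height (3 * b + 1)
  have hlt : ((3 * b + 1) • contrib h).card < ((Finset.range (2 ^ h)).image
      (fun m : ℕ => (m : ℤ))).card := by
    rw [Finset.card_image_of_injective _ Nat.cast_injective, Finset.card_range]
    exact (Finset.card_nsmul_le.trans (Nat.pow_le_pow_left (card_contrib h) _)).trans_lt hh
  obtain ⟨z, hz, hz'⟩ := Finset.exists_mem_notMem_of_card_lt_card hlt
  obtain ⟨m, hm, rfl⟩ := Finset.mem_image.1 hz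
  refine ⟨h, m, (Finset.mem_range.1 hm).le, fun Y hY => ?_⟩
  obtain ⟨Z, hZY, hZ⟩ := Set.exists_subset_card_eq hY
  have h1 : ¬ (closedNbhd (heapTree (2 ^ h)) Z \ Z).ncard ≤ b := by
    intro hle
    apply hz'
    rw [← hZ]
    exact small_boundary h b Z hle
  have h2 := Set.ncard_sdiff_add_ncard_of_subset (subset_closedNbhd (heapTree (2 ^ h)) Z)
    (Set.toFinite _)
  have h3 := Set.ncard_le_ncard (closedNbhd_mono (heapTree (2 ^ h)) hZY) (Set.toFinite _)
  omega

/-- For every `k ≥ 1` there is a finite tree on which `k` bush-cutters cannot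
remove the bush, i.e., whose bush number exceeds `k`. -/
theorem bushNumber_unbounded_on_trees :
    ∀ k : ℕ, 1 ≤ k → ∃ (n : ℕ) (T : SimpleGraph (Fin n)),
      T.Connected ∧ T.IsAcyclic ∧ k < bushNumber T := by
  intro k _
  obtain ⟨h, m, hm, hiso⟩ := exists_isoperimetric (4 * k)
  have hpos : 0 < 2 ^ h := by positivity
  refine ⟨2 ^ h, heapTree _, heapTree_connected _ hpos, heapTree_acyclic _ hpos, ?_⟩
  have hne : {k | BushGameWin (heapTree (2 ^ h)) k}.Nonempty := by
    refine ⟨2 ^ h, fun _ => Finset.univ, fun _ => by simp, 0, ?_⟩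
    rw [Set.sdiff_eq_empty]
    intro x _
    exact subset_closedNbhd _ _ (by simp)
  by_contra hcon
  obtain ⟨S, hS, t, ht⟩ : BushGameWin (heapTree (2 ^ h)) (bushNumber (heapTree (2 ^ h))) :=
    Nat.sInf_mem hne
  have hcut : ∀ (X : Set (Fin (2 ^ h))) (t : ℕ), m + 4 * k ≤ X.ncard →
      m ≤ (X \ closedNbhd (heapTree (2 ^ h)) (S t : Set (Fin (2 ^ h)))).ncard := by
    intro X t hX
    have h1 := ncard_closedNbhd_heap (2 ^ h) k (S t) ((hS t).trans (not_lt.1 hcon))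
    have h2 := Set.ncard_le_ncard_sdiff_add_ncard X
      (closedNbhd (heapTree (2 ^ h)) (S t : Set (Fin (2 ^ h)))) (Set.toFinite _)
    omega
  have hinv : ∀ t, m + 4 * k ≤ (bushSet (heapTree (2 ^ h)) S t).ncard := by
    intro t
    induction t with
    | zero =>
      have h1 := hiso Set.univ (by simpa [Set.ncard_univ] using hm)
      have h2 := Set.ncard_le_ncard (Set.subset_univ (closedNbhd (heapTree (2 ^ h)) Set.univ))
        (Set.toFinite _)
      simp only [bushSet]
      omega
    | succ t ih => exact (hiso _ (hcut _ t ih)).le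
  have h1 := hiso _ (hcut _ t (hinv t))
  rw [ht] at h1
  have h2 : closedNbhd (heapTree (2 ^ h)) ∅ = ∅ := by
    ext x; simp [closedNbhd]
  rw [h2] at h1
  simp at h1
end
end

section
/- For every integer k ≥ 1 there exists a finite tree T such that the graph G obtained from T by adding one new vertex adjacent to every vertex of T satisfies ζ(G) > k. In particular, the localization number is unbounded on planar graphs of treewidth 2. -/
noncomputable section

open SimpleGraph

/-- The answer the cop player receives when probing the set `S` of vertices while the
robber is at vertex `r`: for each probed vertex, its graph distance to `r`. -/
def probeAnswer {V : Type*} [DecidableEq V] (G : SimpleGraph V) (S : Finset V) (r : V) :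
    V → Option ℕ :=
  fun v => if v ∈ S then some (G.dist v r) else none

/-- The list of answers the cop player has received after `t` rounds, when playing
strategy `σ` (which maps each finite history of answers to the next probed set)
against the robber walk `w`.  In round `t` the robber occupies `w t`. -/
def answerHistory {V : Type*} [DecidableEq V] (G : SimpleGraph V)
    (σ : List (V → Option ℕ) → Finset V) (w : ℕ → V) : ℕ → List (V → Option ℕ)
  | 0 => []
  | t + 1 =>
      answerHistory G σ w t ++ [probeAnswer G (σ (answerHistory G σ w t)) (w t)]

/-- The cop player with strategy `σ` locates the robber walk `w`: at some round `t`,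
every robber walk consistent with all the answers received so far occupies the same
vertex as `w` does at round `t`. -/
def Locates {V : Type*} [DecidableEq V] (G : SimpleGraph V)
    (σ : List (V → Option ℕ) → Finset V) (w : ℕ → V) : Prop :=
  ∃ t, ∀ w', IsRobberWalk G w' →
    answerHistory G σ w' (t + 1) = answerHistory G σ w (t + 1) → w' t = w t

/-- The cop player wins the localization game on `G` with `k` cops: there is a strategy
probing at most `k` vertices per round that locates every robber walk after finitely
many rounds. -/
def LocGameWin {V : Type*} [DecidableEq V] (G : SimpleGraph V) (k : ℕ) : Prop :=
  ∃ σ : List (V → Option ℕ) → Finset V,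
    (∀ h, (σ h).card ≤ k) ∧ ∀ w, IsRobberWalk G w → Locates G σ w

/-- The localization number `ζ(G)`: the least number of cops with which the cop player
wins the localization game on `G`. -/
def locNumber {V : Type*} [DecidableEq V] (G : SimpleGraph V) : ℕ :=
  sInf {k | LocGameWin G k}
/-- The graph obtained from `G` by adding one new vertex (`none`) adjacent to every
vertex of `G`. -/
def addUniversal {V : Type*} (G : SimpleGraph V) : SimpleGraph (Option V) :=
  SimpleGraph.fromRel
    (fun x y => (∃ a b, x = some a ∧ y = some b ∧ G.Adj a b) ∨ x = none)

/-- Closed neighborhood as a finset. -/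
def nbF {n : ℕ} (T : SimpleGraph (Fin n)) (S : Finset (Fin n)) : Finset (Fin n) := by
  classical exact Finset.univ.filter (fun x => ∃ a ∈ S, a = x ∨ T.Adj a x)

lemma mem_nbF {n : ℕ} (T : SimpleGraph (Fin n)) (S : Finset (Fin n)) (x : Fin n) :
    x ∈ nbF T S ↔ ∃ a ∈ S, a = x ∨ T.Adj a x := by
  classical
  simp [nbF]

lemma nbF_mono {n : ℕ} (T : SimpleGraph (Fin n)) {S S' : Finset (Fin n)} (h : S ⊆ S') :
    nbF T S ⊆ nbF T S' := by
  intro x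
  rw [mem_nbF, mem_nbF]
  rintro ⟨a, ha, h'⟩
  exact ⟨a, h ha, h'⟩

lemma adjU_none {V : Type*} (T : SimpleGraph V) (x : V) : (addUniversal T).Adj none (some x) := by
  simp [addUniversal]

lemma adjU_some {V : Type*} (T : SimpleGraph V) (x y : V) :
    (addUniversal T).Adj (some x) (some y) ↔ T.Adj x y := by
  simp only [addUniversal, SimpleGraph.fromRel_adj]
  constructor
  · rintro ⟨_, h⟩
    rcases h with (⟨a, b, ha, hb, h⟩ | h) | (⟨a, b, ha, hb, h⟩ | h)
    · cases ha; cases hb; exact h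
    · cases h
    · cases ha; cases hb; exact h.symm
    · cases h
  · intro h
    exact ⟨fun e => h.ne (Option.some.inj e), Or.inl (Or.inl ⟨x, y, rfl, rfl, h⟩)⟩

lemma reachU {V : Type*} (T : SimpleGraph V) (x y : Option V) :
    (addUniversal T).Reachable x y := by
  have key : ∀ z, (addUniversal T).Reachable none z := by
    intro z
    cases z with
    | none => exact SimpleGraph.Reachable.refl _
    | some z => exact (adjU_none T z).reachable
  exact (key x).symm.trans (key y)

lemma distU_none {V : Type*} (T : SimpleGraph V) (x : V) :
    (addUniversal T).dist none (some x) = 1 :=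
  SimpleGraph.dist_eq_one_iff_adj.2 (adjU_none T x)

lemma distU_some {V : Type*} (T : SimpleGraph V) (p x : V) (hne : p ≠ x) (hadj : ¬ T.Adj p x) :
    (addUniversal T).dist (some p) (some x) = 2 := by
  have h2 : (addUniversal T).dist (some p) (some x) ≤ 2 := by
    have := SimpleGraph.dist_le
      (SimpleGraph.Walk.cons (adjU_none T p).symm (SimpleGraph.Walk.cons (adjU_none T x) .nil))
    simpa using this
  have h0 : (addUniversal T).dist (some p) (some x) ≠ 0 := by
    intro h
    exact hne (Option.some.inj ((reachU T _ _).dist_eq_zero_iff.1 h))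
  have h1 : (addUniversal T).dist (some p) (some x) ≠ 1 := by
    intro h
    exact hadj ((adjU_some T p x).1 (SimpleGraph.dist_eq_one_iff_adj.1 h))
  omega

/-- The answer when the robber is on the tree, away from all probes. -/
def nullAnswer {n : ℕ} (S : Finset (Option (Fin n))) : Option (Fin n) → Option ℕ :=
  fun v => if v ∈ S then some (if v = none then 1 else 2) else none

/-- The history of null answers. -/
def nullHist {n : ℕ} (σ : List (Option (Fin n) → Option ℕ) → Finset (Option (Fin n))) :
    ℕ → List (Option (Fin n) → Option ℕ)
  | 0 => []
  | t + 1 => nullHist σ t ++ [nullAnswer (σ (nullHist σ t))]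

/-- The tree vertices probed in round `t` under null answers. -/
def nullProbe {n : ℕ} (σ : List (Option (Fin n) → Option ℕ) → Finset (Option (Fin n))) (t : ℕ) :
    Finset (Fin n) :=
  Finset.univ.filter (fun v => some v ∈ σ (nullHist σ t))

lemma nullHist_eq {n : ℕ} (T : SimpleGraph (Fin n))
    (σ : List (Option (Fin n) → Option ℕ) → Finset (Option (Fin n))) (w : ℕ → Fin n) (t : ℕ)
    (hw : ∀ s < t, w s ∉ nbF T (nullProbe σ s)) :
    answerHistory (addUniversal T) σ (fun s => some (w s)) t = nullHist σ t := by
  induction t with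
  | zero => rfl
  | succ t ih =>
    have ih' := ih (fun s hs => hw s (by omega))
    simp only [answerHistory, nullHist, ih']
    congr 2
    funext v
    simp only [probeAnswer, nullAnswer]
    split_ifs with h1 h2
    · subst h2; rw [distU_none]
    · obtain ⟨p, rfl⟩ := Option.ne_none_iff_exists'.1 h2
      have := hw t (by omega)
      rw [mem_nbF] at this
      push Not at this
      have := this p (by simp [nullProbe, h1])
      rw [distU_some T p (w t) this.1 this.2]
    · rfl

/-- The robber territory under null answers. -/
def terr {n : ℕ} (T : SimpleGraph (Fin n))
    (σ : List (Option (Fin n) → Option ℕ) → Finset (Option (Fin n))) : ℕ → Finset (Fin n)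
  | 0 => Finset.univ \ nbF T (nullProbe σ 0)
  | t + 1 => nbF T (terr T σ t) \ nbF T (nullProbe σ (t + 1))

lemma terr_walk {n : ℕ} (T : SimpleGraph (Fin n))
    (σ : List (Option (Fin n) → Option ℕ) → Finset (Option (Fin n))) (t : ℕ) (x : Fin n)
    (hx : x ∈ terr T σ t) :
    ∃ w : ℕ → Fin n, IsRobberWalk T w ∧ (∀ s ≤ t, w s ∉ nbF T (nullProbe σ s)) ∧ w t = x := by
  induction t generalizing x with
  | zero =>
    refine ⟨fun _ => x, fun _ => Or.inl rfl, ?_, rfl⟩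
    intro s hs
    obtain rfl : s = 0 := by omega
    simp only [terr, Finset.mem_sdiff] at hx
    exact hx.2
  | succ t ih =>
    simp only [terr, Finset.mem_sdiff] at hx
    obtain ⟨h1, h2⟩ := hx
    rw [mem_nbF] at h1
    obtain ⟨a, ha, hax⟩ := h1
    obtain ⟨w, hw, hs, hwt⟩ := ih a ha
    refine ⟨fun s => if s ≤ t then w s else x, ?_, ?_, by simp⟩
    · intro s
      by_cases h : s + 1 ≤ t
      · simp only [h, if_true, show s ≤ t by omega]
        exact hw s
      · by_cases h' : s ≤ t
        · obtain rfl : s = t := by omega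
          simp only [le_refl, if_true, h, if_false, hwt]
          rcases hax with e | e
          · exact Or.inl e.symm
          · exact Or.inr e
        · simp [h, h']
    · intro s hs'
      by_cases h : s ≤ t
      · simp only [h, if_true]; exact hs s h
      · obtain rfl : s = t + 1 := by omega
        simpa using h2

lemma infinite_walk {n : ℕ} (T : SimpleGraph (Fin n)) (B : ℕ → Finset (Fin n))
    (h : ∀ t, ∃ w : ℕ → Fin n, IsRobberWalk T w ∧ (∀ s ≤ t, w s ∉ B s)) :
    ∃ w : ℕ → Fin n, IsRobberWalk T w ∧ (∀ s, w s ∉ B s) := by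
  let K : ℕ → Set (ℕ → Fin n) := fun t => {w | IsRobberWalk T w ∧ (∀ s ≤ t, w s ∉ B s)}
  have hcl : ∀ t, IsClosed (K t) := by
    intro t
    have e : K t = (⋂ s : ℕ, {w | w (s + 1) = w s ∨ T.Adj (w s) (w (s + 1))}) ∩
        ⋂ s : ℕ, ⋂ _ : s ≤ t, {w | w s ∉ B s} := by
      ext w; simp [K, IsRobberWalk]
    rw [e]
    refine IsClosed.inter (isClosed_iInter fun s => ?_)
      (isClosed_iInter fun s => isClosed_iInter fun _ => ?_)
    · have hc : Continuous (fun w : ℕ → Fin n => (w s, w (s + 1))) := by fun_prop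
      exact (isClosed_discrete {p : Fin n × Fin n | p.2 = p.1 ∨ T.Adj p.1 p.2}).preimage hc
    · have hc : Continuous (fun w : ℕ → Fin n => w s) := by fun_prop
      exact (isClosed_discrete {p : Fin n | p ∉ B s}).preimage hc
  obtain ⟨w, hw⟩ := IsCompact.nonempty_iInter_of_sequence_nonempty_isCompact_isClosed K
    (fun t w hw => ⟨hw.1, fun s hs => hw.2 s (by omega)⟩) h (hcl 0).isCompact hcl
  rw [Set.mem_iInter] at hw
  exact ⟨w, (hw 0).1, fun s => (hw s).2 s le_rfl⟩

lemma evade {n : ℕ} (T : SimpleGraph (Fin n)) (k m : ℕ) (hm : 2 ≤ m)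
    (hmn : m + 4 * k ≤ n) (hdeg : ∀ v, (nbF T {v}).card ≤ 4)
    (hiso : ∀ S : Finset (Fin n), S.card = m → m + 4 * k ≤ (nbF T S).card) :
    ¬ LocGameWin (addUniversal T) k := by
  classical
  rintro ⟨σ, hσ, hwin⟩
  have hB : ∀ t, (nbF T (nullProbe σ t)).card ≤ 4 * k := by
    intro t
    have h1 : (nullProbe σ t).card ≤ k := by
      refine le_trans ?_ (hσ (nullHist σ t))
      refine Finset.card_le_card_of_injOn some ?_ (fun a _ b _ h => Option.some.inj h)
      intro v hv
      simpa [nullProbe] using hv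
    have h2 : nbF T (nullProbe σ t) ⊆ (nullProbe σ t).biUnion (fun v => nbF T {v}) := by
      intro x hx
      rw [mem_nbF] at hx
      obtain ⟨a, ha, hax⟩ := hx
      rw [Finset.mem_biUnion]
      exact ⟨a, ha, (mem_nbF _ _ _).2 ⟨a, by simp, hax⟩⟩
    have h3 := Finset.card_le_card h2
    have h4 := Finset.card_biUnion_le_card_mul (nullProbe σ t) (fun v => nbF T {v}) 4
      (fun v _ => hdeg v)
    omega
  have hR : ∀ t, m ≤ (terr T σ t).card := by
    intro t
    induction t with
    | zero =>
      have := Finset.le_card_sdiff (nbF T (nullProbe σ 0)) Finset.univ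
      have h2 := hB 0
      simp only [Finset.card_univ, Fintype.card_fin] at this
      simp only [terr]
      omega
    | succ t ih =>
      obtain ⟨S, hS, hSm⟩ := Finset.exists_subset_card_eq ih
      have h1 := hiso S hSm
      have h2 := Finset.card_le_card (nbF_mono T hS)
      have h3 := Finset.le_card_sdiff (nbF T (nullProbe σ (t + 1))) (nbF T (terr T σ t))
      have h4 := hB (t + 1)
      simp only [terr]
      omega
  have lift : ∀ w : ℕ → Fin n, IsRobberWalk T w →
      IsRobberWalk (addUniversal T) (fun s => some (w s)) := by
    intro w hw t
    rcases hw t with h | h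
    · exact Or.inl (congrArg some h)
    · exact Or.inr ((adjU_some T _ _).2 h)
  obtain ⟨w, hw, hwB⟩ := infinite_walk T (fun t => nbF T (nullProbe σ t)) (by
    intro t
    have : 0 < (terr T σ t).card := by have := hR t; omega
    obtain ⟨x, hx⟩ := Finset.card_pos.1 this
    obtain ⟨w, h1, h2, _⟩ := terr_walk T σ t x hx
    exact ⟨w, h1, h2⟩)
  obtain ⟨t, ht⟩ := hwin _ (lift w hw)
  obtain ⟨x, hx, hxw⟩ := Finset.exists_mem_ne (by have := hR t; omega : 1 < (terr T σ t).card) (w t)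
  obtain ⟨w', h1, h2, h3⟩ := terr_walk T σ t x hx
  have := ht _ (lift w' h1) (by
    rw [nullHist_eq T σ w' (t + 1) (fun s hs => h2 s (by omega)),
      nullHist_eq T σ w (t + 1) (fun s _ => hwB s)])
  exact hxw (h3 ▸ Option.some.inj this)

lemma win_univ {n : ℕ} (T : SimpleGraph (Fin n)) : ∃ k, LocGameWin (addUniversal T) k := by
  refine ⟨_, fun _ => Finset.univ, fun _ => le_rfl, fun w _ => ⟨0, fun w' _ h => ?_⟩⟩
  simp only [answerHistory, List.nil_append, List.cons.injEq, and_true] at h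
  have := congrFun h (w 0)
  simp only [probeAnswer, Finset.mem_univ, if_true, Option.some.injEq, SimpleGraph.dist_self] at this
  exact ((reachU T _ _).dist_eq_zero_iff.1 this).symm

lemma lt_locNumber {n : ℕ} (T : SimpleGraph (Fin n)) (k : ℕ)
    (h : ¬ LocGameWin (addUniversal T) k) : k < locNumber (addUniversal T) := by
  by_contra hlt
  push Not at hlt
  obtain ⟨σ, h1, h2⟩ : LocGameWin (addUniversal T) (locNumber (addUniversal T)) :=
    Nat.sInf_mem (win_univ T)
  exact h ⟨σ, fun x => (h1 x).trans hlt, h2⟩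

/-- The binary heap tree on `{0, …, N-1}`, the parent of `i > 0` being `i / 2`. -/
def heap (N : ℕ) : SimpleGraph (Fin N) where
  Adj i j := i ≠ j ∧ (i.val = j.val / 2 ∨ j.val = i.val / 2)
  symm := ⟨fun _ _ h => ⟨h.1.symm, h.2.symm⟩⟩
  loopless := ⟨fun _ h => h.1 rfl⟩

lemma heap_conn (N : ℕ) (hN : 0 < N) : (heap N).Connected := by
  have key : ∀ i (hi : i < N), (heap N).Reachable ⟨0, hN⟩ ⟨i, hi⟩ := by
    intro i
    induction i using Nat.strong_induction_on with
    | _ i ih =>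
      intro hi
      rcases Nat.eq_zero_or_pos i with rfl | hpos
      · exact SimpleGraph.Reachable.refl _
      · refine (ih (i / 2) (by omega) (by omega)).trans (SimpleGraph.Adj.reachable ?_)
        refine ⟨?_, Or.inl rfl⟩
        intro h
        have := congrArg Fin.val h
        simp only at this
        omega
  have : Nonempty (Fin N) := ⟨⟨0, hN⟩⟩
  exact ⟨fun x y => (key x.1 x.2).symm.trans (key y.1 y.2)⟩

lemma heap_acyclic (N : ℕ) (hN : 0 < N) : (heap N).IsAcyclic := by
  classical
  have hc := heap_conn N hN
  refine (SimpleGraph.isTree_iff_connected_and_card.2 ⟨hc, ?_⟩).isAcyclic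
  have h1 := hc.card_vert_le_card_edgeSet_add_one
  have h2 : (heap N).edgeSet ⊆
      ((Finset.univ.filter (fun i : Fin N => i.val ≠ 0)).image
        (fun i => s(i, (⟨i.val / 2, by omega⟩ : Fin N))) : Finset (Sym2 (Fin N))) := by
    intro e
    induction e using Sym2.ind with
    | _ x y =>
      intro h
      rw [SimpleGraph.mem_edgeSet] at h
      obtain ⟨hne, h⟩ := h
      simp only [Finset.coe_image, Set.mem_image, Finset.coe_filter, Finset.mem_univ, true_and,
        Set.mem_ofPred_eq]
      have hne' : x.val ≠ y.val := fun h => hne (Fin.ext h)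
      rcases h with h | h
      · refine ⟨y, by omega, ?_⟩
        have e : x = ⟨y.val / 2, by omega⟩ := Fin.ext h
        rw [Sym2.eq_swap, ← e]
      · refine ⟨x, by omega, ?_⟩
        have e : y = ⟨x.val / 2, by omega⟩ := Fin.ext h
        rw [← e]
  have h3 := Nat.card_mono (Finset.finite_toSet _) h2
  rw [Nat.card_coe_set_eq (SetLike.coe _), Set.ncard_coe_finset] at h3
  have h4 := h3.trans Finset.card_image_le
  have h5 : (Finset.univ.filter (fun i : Fin N => i.val ≠ 0)).card < N := by
    have := Finset.card_lt_card (s := Finset.univ.filter (fun i : Fin N => i.val ≠ 0))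
      (t := Finset.univ) (by
        rw [Finset.ssubset_univ_iff]
        intro h
        have := Finset.mem_univ (⟨0, hN⟩ : Fin N)
        rw [← h] at this
        simp at this)
    simpa using this
  simp only [Nat.card_eq_fintype_card (α := Fin N), Fintype.card_fin] at h1 ⊢
  omega

lemma heap_deg (N : ℕ) (v : Fin N) : (nbF (heap N) {v}).card ≤ 4 := by
  classical
  have h : (nbF (heap N) {v}).card ≤
      ({v.val, v.val / 2, 2 * v.val, 2 * v.val + 1} : Finset ℕ).card := by
    refine Finset.card_le_card_of_injOn Fin.val ?_ (fun a _ b _ h => Fin.ext h)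
    intro x hx
    rw [Finset.mem_coe, mem_nbF] at hx
    obtain ⟨a, ha, hax⟩ := hx
    rw [Finset.mem_singleton] at ha
    subst ha
    simp only [Finset.coe_insert, Finset.coe_singleton, Set.mem_insert_iff, Set.mem_singleton_iff]
    rcases hax with h | ⟨_, h | h⟩
    · subst h; simp
    · omega
    · omega
  exact h.trans Finset.card_le_four

/-- Subtree sizes in the heap tree on `2 ^ d` vertices. -/
def sz (d i : ℕ) : ℤ := if i = 0 then 2 ^ d else 2 ^ (d - Nat.log 2 i) - 1

lemma sz_zero (d : ℕ) : sz d 0 = 2 ^ d := by simp [sz]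

lemma sz_one (d : ℕ) : sz d 1 = 2 ^ d - 1 := by simp [sz]

lemma sz_big (d i : ℕ) (h : 2 ^ d ≤ i) : sz d i = 0 := by
  have hi : i ≠ 0 := by have := Nat.two_pow_pos d; omega
  have := Nat.le_log_of_pow_le (by norm_num) h
  simp [sz, hi, Nat.sub_eq_zero_of_le this]

lemma sz_rec (d i : ℕ) (h0 : 0 < i) (h : i < 2 ^ d) :
    sz d i = 1 + sz d (2 * i) + sz d (2 * i + 1) := by
  have hl : Nat.log 2 i < d := Nat.log_lt_of_lt_pow (by omega) h
  have h1 : Nat.log 2 (2 * i) = Nat.log 2 i + 1 := by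
    rw [Nat.log_of_one_lt_of_le (by norm_num) (by omega)]
    congr 2; omega
  have h2 : Nat.log 2 (2 * i + 1) = Nat.log 2 i + 1 := by
    rw [Nat.log_of_one_lt_of_le (by norm_num) (by omega)]
    congr 2; omega
  obtain ⟨e, he⟩ : ∃ e, d = Nat.log 2 i + 1 + e := ⟨d - (Nat.log 2 i + 1), by omega⟩
  have e1 : d - Nat.log 2 i = e + 1 := by omega
  have e2 : d - (Nat.log 2 i + 1) = e := by omega
  simp only [sz, h1, h2, e1, e2, show i ≠ 0 by omega, show 2 * i ≠ 0 by omega,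
    show 2 * i + 1 ≠ 0 by omega, if_false]
  ring

lemma sum_double (f : ℕ → ℤ) (M : ℕ) :
    ∑ i ∈ Finset.range (2 * M), f i = ∑ j ∈ Finset.range M, (f (2 * j) + f (2 * j + 1)) := by
  induction M with
  | zero => simp
  | succ M ih =>
    rw [show 2 * (M + 1) = 2 * M + 1 + 1 by ring, Finset.sum_range_succ, Finset.sum_range_succ,
      Finset.sum_range_succ, ih]
    ring

lemma sz_identity (d : ℕ) (χ : ℕ → ℤ) :
    ∑ i ∈ Finset.range (2 ^ d), χ i =
      sz d 0 * χ 0 + ∑ i ∈ Finset.range (2 ^ d), sz d i * (χ i - χ (i / 2)) := by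
  have h1 : ∑ i ∈ Finset.range (2 ^ d), sz d i * χ (i / 2) =
      ∑ i ∈ Finset.range (2 * 2 ^ d), sz d i * χ (i / 2) := by
    refine Finset.sum_subset (Finset.range_mono (by omega)) ?_
    intro x _ hx
    rw [Finset.mem_range, not_lt] at hx
    rw [sz_big d x hx, zero_mul]
  rw [sum_double] at h1
  have h2 : ∀ j, (2 * j) / 2 = j := fun j => by omega
  have h3 : ∀ j, (2 * j + 1) / 2 = j := fun j => by omega
  simp only [h2, h3] at h1
  simp only [mul_sub, Finset.sum_sub_distrib]
  rw [h1, ← Finset.sum_sub_distrib]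
  obtain ⟨M, hM⟩ : ∃ M, 2 ^ d = M + 1 :=
    ⟨2 ^ d - 1, by have := Nat.two_pow_pos d; omega⟩
  rw [hM, Finset.sum_range_succ', Finset.sum_range_succ']
  have h4 : ∀ j ∈ Finset.range M, χ (j + 1) = sz d (j + 1) * χ (j + 1) -
      (sz d (2 * (j + 1)) * χ (j + 1) + sz d (2 * (j + 1) + 1) * χ (j + 1)) := by
    intro j hj
    rw [Finset.mem_range] at hj
    rw [sz_rec d (j + 1) (by omega) (by omega)]
    ring
  rw [Finset.sum_congr rfl h4]
  simp only [mul_zero, zero_add, sz_zero, sz_one]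
  ring

/-- The sums of `e` elements of `W`. -/
def sums (W : Finset ℤ) : ℕ → Finset ℤ
  | 0 => {0}
  | e + 1 => Finset.image₂ (fun a b => a + b) W (sums W e)

lemma sums_card (W : Finset ℤ) (e : ℕ) : (sums W e).card ≤ W.card ^ e := by
  induction e with
  | zero => simp [sums]
  | succ e ih =>
    simp only [sums]
    refine (Finset.card_image₂_le _ _ _).trans ?_
    rw [pow_succ']
    gcongr

lemma mem_sums (W : Finset ℤ) (h0 : (0 : ℤ) ∈ W) (f : ℕ → ℤ) (D : Finset ℕ) (e : ℕ)
    (hD : D.card ≤ e) (hf : ∀ i ∈ D, f i ∈ W) : ∑ i ∈ D, f i ∈ sums W e := by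
  classical
  induction e generalizing D with
  | zero =>
    have : D = ∅ := by simpa using hD
    simp [this, sums]
  | succ e ih =>
    simp only [sums, Finset.mem_image₂]
    rcases D.eq_empty_or_nonempty with rfl | ⟨a, ha⟩
    · exact ⟨0, h0, 0, by simpa using ih ∅ (by simp) (by simp), by simp⟩
    · refine ⟨f a, hf a ha, _, ih (D.erase a) ?_ ?_, Finset.add_sum_erase D f ha⟩
      · rw [Finset.card_erase_of_mem ha]; omega
      · exact fun i hi => hf i (Finset.mem_of_mem_erase hi)

/-- Signed subtree sizes. -/
def wts (d : ℕ) : Finset ℤ :=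
  insert (2 ^ d) ((Finset.range (d + 1)).image (fun h => (2 : ℤ) ^ h - 1) ∪
    (Finset.range (d + 1)).image (fun h => -((2 : ℤ) ^ h - 1)))

lemma wts_card (d : ℕ) : (wts d).card ≤ 2 * d + 3 := by
  refine (Finset.card_insert_le _ _).trans ?_
  have h1 := Finset.card_union_le ((Finset.range (d + 1)).image (fun h => (2 : ℤ) ^ h - 1))
    ((Finset.range (d + 1)).image (fun h => -((2 : ℤ) ^ h - 1)))
  have h2 := Finset.card_image_le (s := Finset.range (d + 1)) (f := fun h => (2 : ℤ) ^ h - 1)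
  have h3 := Finset.card_image_le (s := Finset.range (d + 1)) (f := fun h => -((2 : ℤ) ^ h - 1))
  rw [Finset.card_range] at h2 h3
  omega

lemma wts_pos (d h : ℕ) (hh : h ≤ d) : (2 : ℤ) ^ h - 1 ∈ wts d := by
  refine Finset.mem_insert_of_mem (Finset.mem_union_left _ (Finset.mem_image.2 ⟨h, ?_, rfl⟩))
  simp; omega

lemma wts_neg (d h : ℕ) (hh : h ≤ d) : -((2 : ℤ) ^ h - 1) ∈ wts d := by
  refine Finset.mem_insert_of_mem (Finset.mem_union_right _ (Finset.mem_image.2 ⟨h, ?_, rfl⟩))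
  simp; omega

lemma wts_zero (d : ℕ) : (0 : ℤ) ∈ wts d := by
  simpa using wts_pos d 0 (Nat.zero_le _)

lemma card_mem_sums (d c : ℕ) (S : Finset (Fin (2 ^ d)))
    (hS : (nbF (heap (2 ^ d)) S \ S).card ≤ c) : (S.card : ℤ) ∈ sums (wts d) (3 * c + 1) := by
  classical
  set S' : Finset ℕ := S.map Fin.valEmbedding with hS'
  have hlt : ∀ i ∈ S', i < 2 ^ d := by
    intro i hi
    simp only [hS', Finset.mem_map, Fin.valEmbedding_apply] at hi
    obtain ⟨a, _, rfl⟩ := hi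
    exact a.2
  have hmem : ∀ i (hi : i < 2 ^ d), i ∈ S' ↔ (⟨i, hi⟩ : Fin (2 ^ d)) ∈ S := by
    intro i hi
    simp only [hS', Finset.mem_map, Fin.valEmbedding_apply]
    constructor
    · rintro ⟨a, ha, rfl⟩; exact ha
    · intro h; exact ⟨_, h, rfl⟩
  set χ : ℕ → ℤ := fun i => if i ∈ S' then 1 else 0 with hχ
  have hsum : (S.card : ℤ) = ∑ i ∈ Finset.range (2 ^ d), χ i := by
    rw [hχ, Finset.sum_ite_mem, Finset.inter_eq_right.2 (fun i hi => Finset.mem_range.2 (hlt i hi))]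
    simp [hS']
  set D : Finset ℕ := (Finset.range (2 ^ d)).filter (fun i => χ i ≠ χ (i / 2)) with hD
  set B : Finset ℕ := (nbF (heap (2 ^ d)) S \ S).map Fin.valEmbedding with hB
  have hBmem : ∀ i j, i < 2 ^ d → i ∉ S' → j ∈ S' → (j = i / 2 ∨ i = j / 2) → i ∈ B := by
    intro i j hi hiS hj hij
    simp only [hB, Finset.mem_map, Fin.valEmbedding_apply, Finset.mem_sdiff]
    refine ⟨⟨i, hi⟩, ⟨?_, fun h => hiS ((hmem i hi).2 h)⟩, rfl⟩
    rw [mem_nbF]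
    refine ⟨⟨j, hlt j hj⟩, (hmem _ _).1 hj, Or.inr ⟨?_, hij⟩⟩
    intro h
    have : j = i := congrArg Fin.val h
    subst this
    exact hiS hj
  have hDB : D ⊆ B.biUnion (fun v => {v, 2 * v, 2 * v + 1}) := by
    intro i hi
    simp only [hD, Finset.mem_filter, Finset.mem_range] at hi
    obtain ⟨hi, hne⟩ := hi
    simp only [Finset.mem_biUnion, Finset.mem_insert, Finset.mem_singleton]
    by_cases h1 : i ∈ S'
    · by_cases h2 : i / 2 ∈ S'
      · simp [hχ, h1, h2] at hne
      · exact ⟨i / 2, hBmem _ i (by omega) h2 h1 (Or.inr rfl), by omega⟩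
    · by_cases h2 : i / 2 ∈ S'
      · exact ⟨i, hBmem i _ hi h1 h2 (Or.inl rfl), by omega⟩
      · simp [hχ, h1, h2] at hne
  have hDc : D.card ≤ 3 * c := by
    have h1 := Finset.card_le_card hDB
    have h2 := Finset.card_biUnion_le_card_mul B (fun v => {v, 2 * v, 2 * v + 1}) 3
      (fun v _ => Finset.card_le_three)
    have h3 : B.card ≤ c := by simpa [hB] using hS
    omega
  have hfin : (S.card : ℤ) = sz d 0 * χ 0 + ∑ i ∈ D, sz d i * (χ i - χ (i / 2)) := by
    rw [hsum, sz_identity]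
    congr 1
    symm
    refine Finset.sum_subset (Finset.filter_subset _ _) ?_
    intro x hx hxD
    have : χ x = χ (x / 2) := by
      by_contra h
      exact hxD (Finset.mem_filter.2 ⟨hx, h⟩)
    rw [this, sub_self, mul_zero]
  rw [hfin]
  simp only [sums, Finset.mem_image₂]
  refine ⟨_, ?_, _, mem_sums (wts d) (wts_zero d) _ D _ hDc ?_, rfl⟩
  · by_cases h : 0 ∈ S'
    · simp [hχ, h, sz_zero, wts]
    · simpa [hχ, h] using wts_zero d
  · intro i hi
    simp only [hD, Finset.mem_filter, Finset.mem_range] at hi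
    obtain ⟨_, hne⟩ := hi
    have hi0 : i ≠ 0 := by rintro rfl; simp at hne
    by_cases h1 : i ∈ S'
    · by_cases h2 : i / 2 ∈ S'
      · simp [hχ, h1, h2] at hne
      · simpa [hχ, h1, h2, sz, hi0] using wts_pos d (d - Nat.log 2 i) (Nat.sub_le _ _)
    · by_cases h2 : i / 2 ∈ S'
      · simpa [hχ, h1, h2, sz, hi0] using wts_neg d (d - Nat.log 2 i) (Nat.sub_le _ _)
      · simp [hχ, h1, h2] at hne

lemma exists_depth (E : ℕ) : ∃ d : ℕ, (2 * d + 3) ^ E + 1 < 2 ^ d := by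
  have h := tendsto_pow_const_div_const_pow_of_one_lt (E + 1) (show (1 : ℝ) < 2 by norm_num)
  have h5 : (0 : ℝ) < 1 / (2 * 5 ^ (E + 1)) := by positivity
  obtain ⟨d, hd1, hd2⟩ := ((h.eventually (gt_mem_nhds h5)).and
    (Filter.eventually_ge_atTop 1)).exists
  refine ⟨d, ?_⟩
  rw [div_lt_div_iff₀ (by positivity) (by positivity)] at hd1
  have hd : d ^ (E + 1) * (2 * 5 ^ (E + 1)) < 2 ^ d := by
    have : (d : ℝ) ^ (E + 1) * (2 * 5 ^ (E + 1)) < 2 ^ d := by linarith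
    exact_mod_cast this
  have h1 : (2 * d + 3) ^ E ≤ (5 * d) ^ (E + 1) :=
    (Nat.pow_le_pow_left (by omega) E).trans (Nat.pow_le_pow_right (by omega) (by omega))
  rw [mul_pow] at h1
  have h2 : 1 ≤ 5 ^ (E + 1) * d ^ (E + 1) := Nat.one_le_iff_ne_zero.2 (by positivity)
  nlinarith

lemma heap_iso (c : ℕ) : ∃ d m : ℕ, 2 ≤ m ∧ m ≤ 2 ^ d ∧
    ∀ S : Finset (Fin (2 ^ d)), S.card = m → m + c ≤ (nbF (heap (2 ^ d)) S).card := by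
  classical
  obtain ⟨d, hd⟩ := exists_depth (3 * c + 1)
  have hA : (sums (wts d) (3 * c + 1)).card ≤ (2 * d + 3) ^ (3 * c + 1) :=
    (sums_card _ _).trans (Nat.pow_le_pow_left (wts_card d) _)
  obtain ⟨x, hx, hxA⟩ := Finset.exists_mem_notMem_of_card_lt_card
    (s := sums (wts d) (3 * c + 1)) (t := (Finset.Icc 2 (2 ^ d)).image (fun m : ℕ => (m : ℤ))) (by
      rw [Finset.card_image_of_injective _ Nat.cast_injective, Nat.card_Icc]
      omega)
  obtain ⟨m, hm, rfl⟩ := Finset.mem_image.1 hx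
  rw [Finset.mem_Icc] at hm
  refine ⟨d, m, hm.1, hm.2, fun S hS => ?_⟩
  by_contra hlt
  apply hxA
  rw [← hS]
  apply card_mem_sums
  have hsub : S ⊆ nbF (heap (2 ^ d)) S := fun x hx => (mem_nbF _ _ _).2 ⟨x, hx, Or.inl rfl⟩
  rw [Finset.card_sdiff_of_subset hsub]
  omega

/-- For every `k ≥ 1` there is a finite tree `T` such that the graph obtained from `T`
by adding one vertex adjacent to all vertices of `T` has localization number
greater than `k`. -/
theorem locNumber_unbounded_on_tree_plus_universal_vertex :
    ∀ k : ℕ, 1 ≤ k → ∃ (n : ℕ) (T : SimpleGraph (Fin n)),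
      T.Connected ∧ T.IsAcyclic ∧ k < locNumber (addUniversal T) := by
  intro k _
  obtain ⟨d, m, hm, hmd, hiso⟩ := heap_iso (4 * k)
  have hpos : 0 < 2 ^ d := by positivity
  refine ⟨2 ^ d, heap (2 ^ d), heap_conn _ hpos, heap_acyclic _ hpos, lt_locNumber _ _ ?_⟩
  refine evade _ k m hm ?_ (heap_deg _) hiso
  obtain ⟨S, _, hS⟩ := Finset.exists_subset_card_eq
    (s := (Finset.univ : Finset (Fin (2 ^ d)))) (n := m) (by simpa using hmd)
  have h1 := hiso S hS
  have h2 := Finset.card_le_univ (nbF (heap (2 ^ d)) S)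
  rw [Fintype.card_fin] at h2
  omega
end
end

section
/- For every finite connected simple graph G, if G' denotes the graph obtained from G by adding one new vertex adjacent to every vertex of G, then ζ_b(G) ≤ ζ(G'). -/
noncomputable section

open SimpleGraph

/-- The cop player wins the blind localization game on `G` with `k` cops: since no
information is received, a strategy is just a sequence of probed sets of at most `k`
vertices, and the robber walk `w` is caught at round `t` if `w t` lies in the closed
neighborhood of the set probed at round `t`. -/
def BlindGameWin {V : Type*} (G : SimpleGraph V) (k : ℕ) : Prop :=
  ∃ S : ℕ → Finset V, (∀ t, (S t).card ≤ k) ∧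
    ∀ w, IsRobberWalk G w → ∃ t, w t ∈ closedNbhd G (↑(S t) : Set V)

/-- The blind localization number `ζ_b(G)`. -/
def blindLocNumber {V : Type*} (G : SimpleGraph V) : ℕ :=
  sInf {k | BlindGameWin G k}
/-- The history of answers seen against a robber who is never adjacent to a probe. -/
def evadeHist {V : Type*} [DecidableEq V]
    (σ : List (Option V → Option ℕ) → Finset (Option V)) : ℕ → List (Option V → Option ℕ)
  | 0 => []
  | t + 1 => evadeHist σ t ++
      [fun v => if v ∈ σ (evadeHist σ t) then some (if v = none then 1 else 2) else none]

lemma addUniversal_adj_none {V : Type*} (G : SimpleGraph V) (a : V) :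
    (addUniversal G).Adj none (some a) := by
  simp [addUniversal, SimpleGraph.fromRel_adj]

lemma addUniversal_adj_some {V : Type*} (G : SimpleGraph V) (a b : V) :
    (addUniversal G).Adj (some a) (some b) ↔ G.Adj a b := by
  simp only [addUniversal, SimpleGraph.fromRel_adj]
  constructor
  · rintro ⟨_, (⟨a', b', h1, h2, h⟩ | h) | (⟨a', b', h1, h2, h⟩ | h)⟩
    · cases h1; cases h2; exact h
    · cases h
    · cases h1; cases h2; exact h.symm
    · cases h
  · intro h
    refine ⟨?_, Or.inl (Or.inl ⟨a, b, rfl, rfl, h⟩)⟩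
    intro e
    cases e
    exact G.loopless.irrefl _ h

lemma addUniversal_reachable {V : Type*} (G : SimpleGraph V) (x y : Option V) :
    (addUniversal G).Reachable x y := by
  have h : ∀ z, (addUniversal G).Reachable none z := by
    intro z
    cases z with
    | none => exact SimpleGraph.Reachable.refl _
    | some a => exact (addUniversal_adj_none G a).reachable
  exact (h x).symm.trans (h y)

lemma addUniversal_dist_two {V : Type*} (G : SimpleGraph V) (a b : V) (hne : a ≠ b)
    (hadj : ¬ G.Adj a b) : (addUniversal G).dist (some a) (some b) = 2 := by
  have h1 : (addUniversal G).dist (some a) (some b) ≤ 2 :=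
    SimpleGraph.dist_le
      (SimpleGraph.Walk.cons (addUniversal_adj_none G a).symm
        (SimpleGraph.Walk.cons (addUniversal_adj_none G b) SimpleGraph.Walk.nil))
  have h0 : (addUniversal G).dist (some a) (some b) ≠ 0 := by
    intro h
    have := (addUniversal_reachable G (some a) (some b)).dist_eq_zero_iff.1 h
    exact hne (Option.some.inj this)
  have h2 : (addUniversal G).dist (some a) (some b) ≠ 1 := by
    intro h
    exact hadj ((addUniversal_adj_some G a b).1 (SimpleGraph.dist_eq_one_iff_adj.1 h))
  omega

lemma probeAnswer_evade {V : Type*} [DecidableEq V] (G : SimpleGraph V)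
    (S : Finset (Option V)) (r : V)
    (hr : r ∉ closedNbhd G (↑(Finset.eraseNone S) : Set V)) :
    probeAnswer (addUniversal G) S (some r) =
      fun v => if v ∈ S then some (if v = none then 1 else 2) else none := by
  funext v
  unfold probeAnswer
  by_cases hv : v ∈ S
  · simp only [hv, if_true]
    cases v with
    | none =>
      simpa using SimpleGraph.dist_eq_one_iff_adj.2 (addUniversal_adj_none G r)
    | some a =>
      have ha : a ∈ (↑(Finset.eraseNone S) : Set V) := by simpa using hv
      have := addUniversal_dist_two G a r (fun e => hr ⟨a, ha, Or.inl e⟩)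
        (fun e => hr ⟨a, ha, Or.inr e⟩)
      simpa using this
  · simp [hv]

lemma answerHistory_evade {V : Type*} [DecidableEq V] (G : SimpleGraph V)
    (σ : List (Option V → Option ℕ) → Finset (Option V)) (w : ℕ → V) (n : ℕ)
    (hw : ∀ t < n, w t ∉ closedNbhd G (↑(Finset.eraseNone (σ (evadeHist σ t))) : Set V)) :
    answerHistory (addUniversal G) σ (fun t => some (w t)) n = evadeHist σ n := by
  induction n with
  | zero => rfl
  | succ n ih =>
    have ih' := ih (fun t ht => hw t (by omega))
    simp only [answerHistory, evadeHist, ih']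
    rw [probeAnswer_evade G _ _ (hw n (by omega))]

lemma lift_walk {V : Type*} (G : SimpleGraph V) (w : ℕ → V) (hw : IsRobberWalk G w) :
    IsRobberWalk (addUniversal G) (fun t => some (w t)) := by
  intro t
  rcases hw t with h | h
  · exact Or.inl (congrArg some h)
  · exact Or.inr ((addUniversal_adj_some G _ _).2 h)

lemma locGameWin_pos {V : Type*} [DecidableEq V] [Nonempty V] (G : SimpleGraph V) (k : ℕ)
    (h : LocGameWin (addUniversal G) k) : 1 ≤ k := by
  by_contra hk
  obtain ⟨σ, hσ, hwin⟩ := h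
  have hemp : ∀ l, σ l = ∅ := fun l => Finset.card_eq_zero.1 (by have := hσ l; omega)
  have hist : ∀ (w w' : ℕ → Option V) n,
      answerHistory (addUniversal G) σ w n = answerHistory (addUniversal G) σ w' n := by
    intro w w' n
    induction n with
    | zero => rfl
    | succ n ih =>
      simp only [answerHistory, ih]
      congr 2
      funext v
      simp [probeAnswer, hemp]
  obtain ⟨t, ht⟩ := hwin (fun _ => none) (fun _ => Or.inl rfl)
  have := ht (fun _ => some (Classical.arbitrary V)) (fun _ => Or.inl rfl) (hist _ _ _)
  cases this

lemma locGameWin_exists {V : Type*} [Fintype V] [DecidableEq V] (G : SimpleGraph V) :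
    ∃ k, LocGameWin (addUniversal G) k := by
  refine ⟨_, fun _ => Finset.univ, fun _ => le_refl _, ?_⟩
  intro w _
  refine ⟨0, fun w' _ h => ?_⟩
  simp only [answerHistory, List.nil_append, List.cons.injEq, and_true] at h
  have h2 := congrFun h (w' 0)
  simp only [probeAnswer, Finset.mem_univ, if_true, SimpleGraph.dist_self,
    Option.some.injEq] at h2
  exact (addUniversal_reachable G _ _).dist_eq_zero_iff.1 h2.symm

lemma blind_of_loc {V : Type*} [DecidableEq V] [Nonempty V] (G : SimpleGraph V) (k : ℕ)
    (h : LocGameWin (addUniversal G) k) : BlindGameWin G k := by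
  have hk := locGameWin_pos G k h
  obtain ⟨σ, hσ, hwin⟩ := h
  set S : ℕ → Finset V := fun t => Finset.eraseNone (σ (evadeHist σ t)) with hS
  have hcard : ∀ t, (S t).card ≤ k := fun t =>
    le_trans (by
      rw [← Finset.card_map Function.Embedding.some]
      exact Finset.card_le_card (by rw [Finset.map_some_eraseNone]; exact Finset.erase_subset _ _))
      (hσ (evadeHist σ t))
  by_cases hev : ∀ w, IsRobberWalk G w → ∃ t, w t ∈ closedNbhd G (↑(S t) : Set V)
  · exact ⟨S, hcard, hev⟩
  · push Not at hev
    obtain ⟨w, hw, hwS⟩ := hev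
    obtain ⟨T, hT⟩ := hwin _ (lift_walk G w hw)
    refine ⟨fun t => if t = T + 1 then {w T} else S t, ?_, ?_⟩
    · intro t
      by_cases ht : t = T + 1
      · simpa [ht] using hk
      · simpa [ht] using hcard t
    · intro w' hw'
      by_contra hc
      push Not at hc
      have e1 := answerHistory_evade G σ w' (T + 1) (fun t ht => by
        have := hc t
        rwa [if_neg (by omega)] at this)
      have e2 := answerHistory_evade G σ w (T + 1) (fun t _ => hwS t)
      have e3 : w' T = w T := Option.some.inj (hT _ (lift_walk G w' hw') (e1.trans e2.symm))
      apply hc (T + 1)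
      refine ⟨w T, by simp, ?_⟩
      rw [← e3]
      exact (hw' T).imp Eq.symm id

/-- For every finite connected simple graph `G`, the blind localization number of `G`
is at most the localization number of the graph obtained from `G` by adding a
universal vertex. -/
theorem blindLocNumber_le_locNumber_addUniversal {V : Type*} [Fintype V] [DecidableEq V]
    (G : SimpleGraph V) (hG : G.Connected) :
    blindLocNumber G ≤ locNumber (addUniversal G) := by
  haveI := hG.nonempty
  have h : LocGameWin (addUniversal G) (locNumber (addUniversal G)) :=
    Nat.sInf_mem (locGameWin_exists G)
  exact Nat.sInf_le (blind_of_loc G _ h)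
end
end

section
/- Every finite connected simple graph G satisfies B(G) ≤ ζ_b(G), i.e., the bush number is at most the blind localization number. -/
noncomputable section

open SimpleGraph

theorem exists_walk_of_mem_bushSet {V : Type*} (G : SimpleGraph V) (S : ℕ → Finset V) (t : ℕ) :
    ∀ x ∈ bushSet G S t, ∃ w : ℕ → V, IsRobberWalk G w ∧ (∀ i, t ≤ i → w i = x) ∧
      ∀ i < t, w i ∉ closedNbhd G (↑(S i) : Set V) := by
  induction t with
  | zero =>
    intro x _
    exact ⟨fun _ => x, fun _ => Or.inl rfl, fun _ _ => rfl, fun i hi => absurd hi (by omega)⟩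
  | succ t ih =>
    rintro x ⟨a, ⟨ha, hna⟩, hax⟩
    obtain ⟨w, hw, hwa, hwS⟩ := ih a ha
    refine ⟨fun i => if i ≤ t then w i else x, ?_, ?_, ?_⟩
    · intro i
      rcases lt_trichotomy i t with h | h | h
      · have h1 : i + 1 ≤ t := h
        simpa [h.le, h1] using hw i
      · subst h
        have h2 := hwa i le_rfl
        simp only [le_refl, if_true, h2, show ¬ (i + 1 ≤ i) by omega, if_false]
        rcases hax with h | h
        · exact Or.inl h.symm
        · exact Or.inr h
      · left
        simp [show ¬ (i + 1 ≤ t) by omega, show ¬ (i ≤ t) by omega]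
    · intro i hi
      simp [show ¬ (i ≤ t) by omega]
    · intro i hi
      have h1 : i ≤ t := by omega
      simp only [h1, if_true]
      rcases h1.lt_or_eq with h | h
      · exact hwS i h
      · subst h
        rw [hwa i le_rfl]
        exact hna

theorem BlindGameWin.bushGameWin {V : Type*} [Finite V] {G : SimpleGraph V} {k : ℕ}
    (h : BlindGameWin G k) : BushGameWin G k := by
  obtain ⟨S, hS, hwin⟩ := h
  refine ⟨S, hS, ?_⟩
  by_contra! hne
  let : TopologicalSpace V := ⊥
  have : DiscreteTopology V := ⟨rfl⟩
  let C : ℕ → Set (ℕ → V) := fun t =>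
    {w | IsRobberWalk G w} ∩ {w | ∀ i ≤ t, w i ∉ closedNbhd G (↑(S i) : Set V)}
  have hclosed : ∀ t, IsClosed (C t) := by
    intro t
    apply IsClosed.inter
    · simp only [IsRobberWalk, Set.ofPred_forall]
      refine isClosed_iInter fun i => ?_
      have hc : Continuous (fun w : ℕ → V => (w i, w (i + 1))) := by fun_prop
      exact (isClosed_discrete {p : V × V | p.2 = p.1 ∨ G.Adj p.1 p.2}).preimage hc
    · simp only [Set.ofPred_forall]
      refine isClosed_iInter fun i => isClosed_iInter fun _ => ?_
      have hc : Continuous (fun w : ℕ → V => w i) := continuous_apply i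
      exact (isClosed_discrete (closedNbhd G (↑(S i) : Set V))ᶜ).preimage hc
  obtain ⟨w, hw⟩ := IsCompact.nonempty_iInter_of_sequence_nonempty_isCompact_isClosed C
    (fun t w hw => ⟨hw.1, fun i hi => hw.2 i (by omega)⟩)
    (fun t => by
      obtain ⟨x, hx, hxS⟩ := hne t
      obtain ⟨w, hw, hwx, hwS⟩ := exists_walk_of_mem_bushSet G S t x hx
      refine ⟨w, hw, fun i hi => ?_⟩
      rcases hi.lt_or_eq with h | h
      · exact hwS i h
      · subst h
        rw [hwx i le_rfl]
        exact hxS)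
    (hclosed 0).isCompact hclosed
  rw [Set.mem_iInter] at hw
  obtain ⟨t, ht⟩ := hwin w (hw 0).1
  exact (hw t).2 t le_rfl ht

/-- Every finite connected simple graph `G` satisfies `B(G) ≤ ζ_b(G)`: the bush number
is at most the blind localization number. -/
theorem bushNumber_le_blindLocNumber {V : Type*} [Fintype V] (G : SimpleGraph V)
    (hG : G.Connected) :
    bushNumber G ≤ blindLocNumber G := by
  have hne : {k | BlindGameWin G k}.Nonempty := by
    obtain ⟨v⟩ := hG.nonempty
    exact ⟨Fintype.card V, fun _ => Finset.univ, fun _ => le_rfl, fun w _ =>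
      ⟨0, w 0, by simp, Or.inl rfl⟩⟩
  exact Nat.sInf_le (BlindGameWin.bushGameWin (Nat.sInf_mem hne))
end
end

section
/- Every finite connected simple graph G satisfies ζ(G) ≤ pw(G), where pw(G) is the pathwidth of G. -/
noncomputable section

open SimpleGraph

/-- `X 0, …, X (n-1)` is a path-decomposition of `G`: every vertex lies in some bag,
every edge has both endpoints in some bag, and every vertex occupies a consecutive
set of bags. -/
def IsPathDecomposition {V : Type*} (G : SimpleGraph V) (n : ℕ)
    (X : Fin n → Finset V) : Prop :=
  (∀ v : V, ∃ i, v ∈ X i) ∧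
  (∀ u v : V, G.Adj u v → ∃ i, u ∈ X i ∧ v ∈ X i) ∧
  (∀ i j l : Fin n, i ≤ j → j ≤ l → ∀ v : V, v ∈ X i → v ∈ X l → v ∈ X j)

/-- The pathwidth of `G`: the minimum over all path-decompositions of the maximum bag
size minus one. -/
def pathwidth {V : Type*} (G : SimpleGraph V) : ℕ :=
  sInf {w | ∃ (n : ℕ) (X : Fin n → Finset V),
    IsPathDecomposition G n X ∧ ∀ i, (X i).card ≤ w + 1}

open Classical in
/-- Vertices of rank below `m` with a neighbor of rank at least `m`. -/
def bdry {V : Type*} [Fintype V] (G : SimpleGraph V) (r : V → ℕ) (m : ℕ) : Finset V :=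
  Finset.univ.filter (fun x => r x < m ∧ ∃ y, G.Adj x y ∧ m ≤ r y)

theorem mem_bdry {V : Type*} [Fintype V] (G : SimpleGraph V) (r : V → ℕ) (m : ℕ) (x : V) :
    x ∈ bdry G r m ↔ r x < m ∧ ∃ y, G.Adj x y ∧ m ≤ r y := by
  simp [bdry]

theorem exists_rank {V : Type*} [Fintype V] [DecidableEq V] (G : SimpleGraph V) (w n : ℕ)
    (X : Fin n → Finset V) (hX : IsPathDecomposition G n X) (hw : ∀ i, (X i).card ≤ w + 1) :
    ∃ r : V → ℕ, Function.Injective r ∧ ∀ m, (bdry G r m).card ≤ w := by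
  classical
  obtain ⟨h1, h2, h3⟩ := hX
  have hmin : ∀ v, ∃ i, v ∈ X i ∧ ∀ j, v ∈ X j → i ≤ j := by
    intro v
    obtain ⟨i, hi⟩ := h1 v
    obtain ⟨a, ha, hb⟩ := Finset.exists_min_image (Finset.univ.filter (fun i => v ∈ X i)) id
      ⟨i, by simp [hi]⟩
    exact ⟨a, by simpa using ha, fun j hj => hb j (by simp [hj])⟩
  choose f hf hfm using hmin
  let e := Fintype.equivFin V
  let r : V → ℕ := fun v => Fintype.card V * (f v : ℕ) + (e v : ℕ)
  have hmono : ∀ a b, r a ≤ r b → f a ≤ f b := by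
    intro a b hab
    have ha : r a / Fintype.card V = f a := by
      have := (e a).2
      simp only [r]
      rw [Nat.mul_add_div (by omega), Nat.div_eq_of_lt this]; simp
    have hb : r b / Fintype.card V = f b := by
      have := (e b).2
      simp only [r]
      rw [Nat.mul_add_div (by omega), Nat.div_eq_of_lt this]; simp
    have := Nat.div_le_div_right (c := Fintype.card V) hab
    rw [ha, hb] at this
    exact this
  refine ⟨r, ?_, ?_⟩
  · intro a b hab
    have h := le_antisymm (hmono a b hab.le) (hmono b a hab.ge)
    simp only [r, h] at hab
    apply e.injective
    apply Fin.ext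
    omega
  · intro m
    rcases (bdry G r m).eq_empty_or_nonempty with h | ⟨x, hx⟩
    · simp [h]
    · obtain ⟨_, y, _, hy⟩ := (mem_bdry _ _ _ _).1 hx
      obtain ⟨v, hv, hvm⟩ := Finset.exists_min_image (Finset.univ.filter (fun y => m ≤ r y)) r
        ⟨y, by simp [hy]⟩
      have hv : m ≤ r v := by simpa using hv
      have hsub : insert v (bdry G r m) ⊆ X (f v) := by
        intro z hz
        rcases Finset.mem_insert.1 hz with rfl | hz
        · exact hf _
        · obtain ⟨hz1, y', hadj, hy'⟩ := (mem_bdry _ _ _ _).1 hz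
          obtain ⟨b, hb1, hb2⟩ := h2 _ _ hadj
          have h5 : f v ≤ f y' := hmono _ _ (hvm y' (by simp [hy']))
          exact h3 (f z) (f v) b (hmono _ _ (by omega)) (h5.trans (hfm _ _ hb2)) z (hf z) hb1
      have h6 : v ∉ bdry G r m := by
        intro h
        have := ((mem_bdry _ _ _ _).1 h).1
        omega
      have := (Finset.card_le_card hsub).trans (hw _)
      rw [Finset.card_insert_of_notMem h6] at this
      omega

theorem exists_probe {V : Type*} [Fintype V] [DecidableEq V] [Nontrivial V] (G : SimpleGraph V)
    (hG : G.Connected) (w : ℕ) (r : V → ℕ) (hr : Function.Injective r)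
    (hb : ∀ m, (bdry G r m).card ≤ w) (m : ℕ) :
    ∃ P : Finset V, P.card ≤ w ∧ ∀ x y, (m ≤ r x ∨ x ∈ bdry G r m) →
      (m ≤ r y ∨ y ∈ bdry G r m) → (∀ p ∈ P, G.dist p x = G.dist p y) → r x ≤ m → x = y := by
  have key : ∀ (P : Finset V) (x y : V), (∀ p ∈ P, G.dist p x = G.dist p y) → x ∈ P → x = y := by
    intro P x y h hx
    have := h x hx
    rw [dist_self] at this
    exact (hG.dist_eq_zero_iff).1 this.symm
  have key2 : ∀ (P : Finset V) (x y : V), (∀ p ∈ P, G.dist p x = G.dist p y) → y ∈ P → x = y := by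
    intro P x y h hy
    exact (key P y x (fun p hp => (h p hp).symm) hy).symm
  by_cases hv : ∃ v, r v = m
  · obtain ⟨v, hv⟩ := hv
    have hxv : ∀ x, (m ≤ r x ∨ x ∈ bdry G r m) → r x ≤ m → x = v ∨ x ∈ bdry G r m := by
      intro x hx hxm
      rcases hx with h | h
      · left; apply hr; omega
      · exact Or.inr h
    by_cases hA : (bdry G r m).card < w
    · refine ⟨insert v (bdry G r m), (Finset.card_insert_le _ _).trans hA, ?_⟩
      intro x y hx hy h hxm
      exact key _ x y h (Finset.mem_insert.2 (hxv x hx hxm))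
    by_cases hB : ∃ u ∈ bdry G r m, ∀ y, G.Adj u y → m ≤ r y → y = v
    · obtain ⟨u, hu, huv⟩ := hB
      refine ⟨_, hb m, ?_⟩
      intro x y hx hy h hxm
      rcases hxv x hx hxm with rfl | hx'
      · obtain ⟨_, z, hz, hzm⟩ := (mem_bdry _ _ _ _).1 hu
        obtain rfl := huv z hz hzm
        have h1 := h u hu
        rw [dist_eq_one_iff_adj.2 hz] at h1
        have h2 := dist_eq_one_iff_adj.1 h1.symm
        rcases hy with hy | hy
        · exact (huv y h2 hy).symm
        · exact key2 _ _ _ h hy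
      · exact key _ x y h hx'
    · push Not at hB
      have hsub : bdry G r m ⊆ bdry G r (m+1) := by
        intro u hu
        obtain ⟨y, h1, h2, h3⟩ := hB u hu
        have h4 := ((mem_bdry _ _ _ _).1 hu).1
        have : r y ≠ m := fun h => h3 (hr (h.trans hv.symm))
        exact (mem_bdry _ _ _ _).2 ⟨by omega, y, h1, by omega⟩
      have hvn : v ∉ bdry G r m := by
        intro h
        have := ((mem_bdry _ _ _ _).1 h).1
        omega
      have hvn' : v ∉ bdry G r (m+1) := by
        intro h
        have h1 := Finset.card_le_card (Finset.insert_subset h hsub)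
        rw [Finset.card_insert_of_notMem hvn] at h1
        have := hb (m+1)
        omega
      have hN : ∀ y, G.Adj v y → y ∈ bdry G r m := by
        intro y hy
        have h1 : ¬ (m + 1 ≤ r y) := fun h =>
          hvn' ((mem_bdry _ _ _ _).2 ⟨by omega, y, hy, h⟩)
        have h2 : r y ≠ m := fun h => hy.ne (hr (hv.trans h.symm))
        exact (mem_bdry _ _ _ _).2 ⟨by omega, v, hy.symm, hv.ge⟩
      obtain ⟨u, hu⟩ := hG.preconnected.exists_adj_of_nontrivial v
      refine ⟨insert v ((bdry G r m).erase u), ?_, ?_⟩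
      · refine (Finset.card_insert_le _ _).trans ?_
        rw [Finset.card_erase_add_one (hN u hu)]
        exact hb m
      · intro x y hx hy h hxm
        by_cases hxu : x = u
        · subst hxu
          have h1 := h v (Finset.mem_insert_self _ _)
          rw [dist_eq_one_iff_adj.2 hu] at h1
          have h2 := hN y (dist_eq_one_iff_adj.1 h1.symm)
          by_cases hyx : y = x
          · exact hyx.symm
          · exact key2 _ _ _ h (by simp [hyx, h2])
        · apply key _ x y h
          rcases hxv x hx hxm with rfl | hx'
          · simp
          · simp [hxu, hx']
  · refine ⟨_, hb m, ?_⟩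
    intro x y hx hy h hxm
    apply key _ x y h
    rcases hx with hx | hx
    · exact absurd ⟨x, le_antisymm hxm hx⟩ hv
    · exact hx

theorem answerHistory_length {V : Type*} [DecidableEq V] (G : SimpleGraph V)
    (σ : List (V → Option ℕ) → Finset V) (w : ℕ → V) (t : ℕ) :
    (answerHistory G σ w t).length = t := by
  induction t with
  | zero => rfl
  | succ t ih => simp [answerHistory, ih]

theorem win_of_rank {V : Type*} [Fintype V] [DecidableEq V] [Nontrivial V] (G : SimpleGraph V)
    (hG : G.Connected) (k : ℕ) (r : V → ℕ) (hr : Function.Injective r)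
    (hb : ∀ m, (bdry G r m).card ≤ k) : LocGameWin G k := by
  choose P hPk hP using exists_probe G hG k r hr hb
  refine ⟨fun h => P h.length, fun h => hPk _, ?_⟩
  intro w hw
  by_contra hloc
  set σ : List (V → Option ℕ) → Finset V := fun h => P h.length with hσ
  have hstep : ∀ w' w'' : ℕ → V, ∀ t, answerHistory G σ w' (t+1) = answerHistory G σ w'' (t+1) →
      answerHistory G σ w' t = answerHistory G σ w'' t ∧
        ∀ p ∈ P t, G.dist p (w' t) = G.dist p (w'' t) := by
    intro w' w'' t h
    simp only [answerHistory] at h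
    obtain ⟨h1, h2⟩ := List.append_inj h (by simp [answerHistory_length])
    refine ⟨h1, fun p hp => ?_⟩
    simp only [List.cons.injEq, and_true, hσ, answerHistory_length] at h2
    have := congrFun h2 p
    simpa [probeAnswer, hp] using this
  have inv : ∀ t, ∀ w', IsRobberWalk G w' → answerHistory G σ w' t = answerHistory G σ w t →
      (t ≤ r (w' t) ∨ w' t ∈ bdry G r t) := by
    intro t
    induction t with
    | zero => intro w' _ _; left; omega
    | succ t ih =>
      intro w' hw' heq
      have hgt : t + 1 ≤ r (w' t) := by
        by_contra hlt
        apply hloc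
        refine ⟨t, ?_⟩
        have main : ∀ w'', IsRobberWalk G w'' →
            answerHistory G σ w'' (t+1) = answerHistory G σ w (t+1) → w' t = w'' t := by
          intro w'' hw'' heq'
          exact hP t _ _ (ih w' hw' (hstep _ _ _ heq).1) (ih w'' hw'' (hstep _ _ _ heq').1)
            (hstep _ _ _ (heq.trans heq'.symm)).2 (by omega)
        intro w'' hw'' heq'
        rw [← main w'' hw'' heq', ← main w hw rfl]
      rcases hw' t with h | h
      · left; rw [h]; exact hgt
      · by_cases h' : t + 1 ≤ r (w' (t+1))
        · exact Or.inl h'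
        · exact Or.inr ((mem_bdry _ _ _ _).2 ⟨by omega, _, h.symm, hgt⟩)
  have hbound : ∀ v, r v < Finset.univ.sup r + 1 := fun v =>
    Nat.lt_succ_of_le (Finset.le_sup (Finset.mem_univ v))
  rcases inv (Finset.univ.sup r + 1) w hw rfl with h | h
  · have := hbound (w (Finset.univ.sup r + 1))
    omega
  · obtain ⟨_, y, _, hy⟩ := (mem_bdry _ _ _ _).1 h
    have := hbound y
    omega

/-- Every finite connected simple graph `G` satisfies `ζ(G) ≤ pw(G)`. -/
theorem locNumber_le_pathwidth {V : Type*} [Fintype V] [DecidableEq V]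
    (G : SimpleGraph V) (hG : G.Connected) :
    locNumber G ≤ pathwidth G := by
  have hne : {w | ∃ (n : ℕ) (X : Fin n → Finset V),
      IsPathDecomposition G n X ∧ ∀ i, (X i).card ≤ w + 1}.Nonempty := by
    refine ⟨Fintype.card V, 1, fun _ => Finset.univ, ⟨?_, ?_, ?_⟩, ?_⟩
    · intro v; exact ⟨0, Finset.mem_univ v⟩
    · intro u v _; exact ⟨0, Finset.mem_univ u, Finset.mem_univ v⟩
    · intro _ _ _ _ _ v _ _; exact Finset.mem_univ v
    · intro _; exact (Finset.card_le_univ _).trans (Nat.le_succ _)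
  obtain ⟨n, X, hX, hw⟩ := Nat.sInf_mem hne
  apply Nat.sInf_le
  rcases subsingleton_or_nontrivial V with hV | hV
  · exact ⟨fun _ => ∅, fun _ => by simp, fun w _ => ⟨0, fun w' _ _ => Subsingleton.elim _ _⟩⟩
  · obtain ⟨r, hr, hb⟩ := exists_rank G _ n X hX hw
    exact win_of_rank G hG _ r hr hb
end
end

section
/- Let G be a finite connected simple graph on n vertices with diameter 2, and let k be the minimum size of a locating set of G. Let G' be the graph obtained from G by adding n+1 new pairwise non-adjacent vertices x_1, …, x_{n+1}, each adjacent to every vertex of G. Then ζ(G') = k + 1. -/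
noncomputable section

open SimpleGraph

/-- `L` is a locating set of `G`: distinct vertices outside `L` have distinct closed
neighborhoods within `L`. -/
def IsLocatingSet {V : Type*} (G : SimpleGraph V) (L : Set V) : Prop :=
  ∀ u v : V, u ∉ L → v ∉ L → u ≠ v →
    {x ∈ L | x = u ∨ G.Adj x u} ≠ {x ∈ L | x = v ∨ G.Adj x v}

/-- `L` is a dominating set of `G`: every vertex is in the closed neighborhood of `L`. -/
def IsDominatingSet {V : Type*} (G : SimpleGraph V) (L : Set V) : Prop :=
  ∀ v : V, ∃ x ∈ L, x = v ∨ G.Adj x v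

/-- The graph obtained from `G` by adding `c` new pairwise non-adjacent vertices, each
adjacent to every vertex of `G`. -/
def addApexes {V : Type*} (G : SimpleGraph V) (c : ℕ) : SimpleGraph (V ⊕ Fin c) :=
  SimpleGraph.fromRel (fun x y =>
    (∃ a b, x = Sum.inl a ∧ y = Sum.inl b ∧ G.Adj a b) ∨
    (∃ a b, x = Sum.inl a ∧ y = Sum.inr b))


section helpers

variable {V : Type*} {G : SimpleGraph V} {c : ℕ}

lemma aa_inl_inl (a b : V) :
    (addApexes G c).Adj (Sum.inl a) (Sum.inl b) ↔ G.Adj a b := by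
  simp only [addApexes, SimpleGraph.fromRel_adj]
  constructor
  · rintro ⟨-, (⟨a', b', h1, h2, h⟩ | ⟨a', b', h1, h2⟩) | (⟨a', b', h1, h2, h⟩ | ⟨a', b', h1, h2⟩)⟩
    · cases h1; cases h2; exact h
    · cases h2
    · cases h1; cases h2; exact h.symm
    · cases h2
  · intro h
    exact ⟨fun e => h.ne (Sum.inl.inj e), Or.inl (Or.inl ⟨a, b, rfl, rfl, h⟩)⟩

lemma aa_inl_inr (a : V) (i : Fin c) :
    (addApexes G c).Adj (Sum.inl a) (Sum.inr i) := by
  simp [addApexes, SimpleGraph.fromRel_adj]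

lemma aa_inr_inl (a : V) (i : Fin c) :
    (addApexes G c).Adj (Sum.inr i) (Sum.inl a) := (aa_inl_inr a i).symm

lemma aa_inr_inr (i j : Fin c) :
    ¬ (addApexes G c).Adj (Sum.inr i) (Sum.inr j) := by
  simp [addApexes, SimpleGraph.fromRel_adj]

lemma dist_two_of_common {W : Type*} {H : SimpleGraph W} {u v z : W} (hne : u ≠ v)
    (hna : ¬ H.Adj u v) (h1 : H.Adj u z) (h2 : H.Adj z v) : H.dist u v = 2 := by
  have hr : H.Reachable u v := h1.reachable.trans h2.reachable
  have h0 : H.dist u v ≠ 0 := fun h => hne (hr.dist_eq_zero_iff.mp h)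
  have h1' : H.dist u v ≠ 1 := fun h => hna (SimpleGraph.dist_eq_one_iff_adj.mp h)
  have h2' : H.dist u v ≤ 2 :=
    SimpleGraph.dist_le (SimpleGraph.Walk.cons h1 (SimpleGraph.Walk.cons h2 SimpleGraph.Walk.nil))
  omega

lemma dist_inl_inr (a : V) (i : Fin c) :
    (addApexes G c).dist (Sum.inl a) (Sum.inr i) = 1 :=
  SimpleGraph.dist_eq_one_iff_adj.mpr (aa_inl_inr a i)

lemma dist_inr_inl (a : V) (i : Fin c) :
    (addApexes G c).dist (Sum.inr i) (Sum.inl a) = 1 :=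
  SimpleGraph.dist_eq_one_iff_adj.mpr (aa_inr_inl a i)

lemma dist_inr_inr (v : V) {i j : Fin c} (h : i ≠ j) :
    (addApexes G c).dist (Sum.inr i) (Sum.inr j) = 2 :=
  dist_two_of_common (fun e => h (Sum.inr.inj e)) (aa_inr_inr i j) (aa_inr_inl v i) (aa_inl_inr v j)

lemma dist_inl_inl (i : Fin c) {a b : V} (h : a ≠ b) (hn : ¬ G.Adj a b) :
    (addApexes G c).dist (Sum.inl a) (Sum.inl b) = 2 :=
  dist_two_of_common (fun e => h (Sum.inl.inj e)) (fun e => hn ((aa_inl_inl a b).mp e))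
    (aa_inl_inr a i) (aa_inr_inl b i)

/-- A pair of distinct vertices both in `V` or both apexes. -/
def GoodPair (p : (V ⊕ Fin c) × (V ⊕ Fin c)) : Prop :=
  (∃ u v : V, u ≠ v ∧ p = (Sum.inl u, Sum.inl v)) ∨
  (∃ i j : Fin c, i ≠ j ∧ p = (Sum.inr i, Sum.inr j))

/-- Two unprobed apexes get the same answer. -/
lemma answer_apex [DecidableEq V] (v : V) (S : Finset (V ⊕ Fin c)) {i j : Fin c}
    (hi : Sum.inr i ∉ S) (hj : Sum.inr j ∉ S) :
    probeAnswer (addApexes G c) S (Sum.inr i) = probeAnswer (addApexes G c) S (Sum.inr j) := by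
  funext z
  unfold probeAnswer
  by_cases hz : z ∈ S
  · rw [if_pos hz, if_pos hz]
    rcases z with a | l
    · rw [dist_inl_inr, dist_inl_inr]
    · rw [dist_inr_inr v, dist_inr_inr v]
      · rintro rfl; exact hj hz
      · rintro rfl; exact hi hz
  · rw [if_neg hz, if_neg hz]

/-- Two unprobed base vertices with the same neighborhood in the probed set get the same answer. -/
lemma answer_base [DecidableEq V] (i : Fin c) (S : Finset (V ⊕ Fin c)) {u v : V}
    (hu : Sum.inl u ∉ S) (hv : Sum.inl v ∉ S)
    (h : ∀ a, Sum.inl a ∈ S → (G.Adj a u ↔ G.Adj a v)) :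
    probeAnswer (addApexes G c) S (Sum.inl u) = probeAnswer (addApexes G c) S (Sum.inl v) := by
  funext z
  unfold probeAnswer
  by_cases hz : z ∈ S
  · rw [if_pos hz, if_pos hz]
    rcases z with a | l
    · have hau : a ≠ u := by rintro rfl; exact hu hz
      have hav : a ≠ v := by rintro rfl; exact hv hz
      by_cases hadj : G.Adj a u
      · rw [SimpleGraph.dist_eq_one_iff_adj.mpr ((aa_inl_inl a u).mpr hadj),
          SimpleGraph.dist_eq_one_iff_adj.mpr ((aa_inl_inl a v).mpr ((h a hz).mp hadj))]
      · rw [dist_inl_inl i hau hadj, dist_inl_inl i hav (fun e => hadj ((h a hz).mpr e))]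
    · rw [dist_inr_inl, dist_inr_inl]
  · rw [if_neg hz, if_neg hz]

/-- Robber step. -/
lemma robber_step [Fintype V] [DecidableEq V] (v0 : V) (k : ℕ)
    (hkn : k < Fintype.card V)
    (hmin : ∀ L : Set V, L.ncard < k → ¬ IsLocatingSet G L)
    (S : Finset (V ⊕ Fin (Fintype.card V + 1))) (hS : S.card ≤ k)
    (p : (V ⊕ Fin (Fintype.card V + 1)) × (V ⊕ Fin (Fintype.card V + 1))) (hp : GoodPair p) :
    ∃ q : (V ⊕ Fin (Fintype.card V + 1)) × (V ⊕ Fin (Fintype.card V + 1)), GoodPair q ∧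
      (q.1 = p.1 ∨ (addApexes G (Fintype.card V + 1)).Adj p.1 q.1) ∧
      (q.2 = p.2 ∨ (addApexes G (Fintype.card V + 1)).Adj p.2 q.2) ∧
      probeAnswer (addApexes G (Fintype.card V + 1)) S q.1 =
        probeAnswer (addApexes G (Fintype.card V + 1)) S q.2 := by
  rcases hp with ⟨u, v, huv, rfl⟩ | ⟨i, j, hij, rfl⟩
  · -- go to two unprobed apexes
    let T : Finset (Fin (Fintype.card V + 1)) :=
      Finset.univ.filter (fun i => (Sum.inr i : V ⊕ Fin (Fintype.card V + 1)) ∈ S)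
    have hT : T.card ≤ S.card :=
      Finset.card_le_card_of_injOn Sum.inr (fun i hi => by simpa [T] using hi)
        (Sum.inr_injective.injOn)
    have hTc : 1 < (Tᶜ).card := by
      rw [Finset.card_compl, Fintype.card_fin]; omega
    obtain ⟨i, hi, j, hj, hij⟩ := Finset.one_lt_card.mp hTc
    refine ⟨(Sum.inr i, Sum.inr j), Or.inr ⟨i, j, hij, rfl⟩, Or.inr (aa_inl_inr _ _),
      Or.inr (aa_inl_inr _ _), answer_apex v0 S ?_ ?_⟩
    · simpa [T] using hi
    · simpa [T] using hj
  · by_cases hap : Sum.inr i ∉ S ∧ Sum.inr j ∉ S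
    · exact ⟨(Sum.inr i, Sum.inr j), Or.inr ⟨i, j, hij, rfl⟩, Or.inl rfl, Or.inl rfl,
        answer_apex v0 S hap.1 hap.2⟩
    · have hex : ∃ l, (Sum.inr l : V ⊕ Fin (Fintype.card V + 1)) ∈ S := by
        by_contra hcon
        push Not at hcon
        exact hap ⟨hcon i, hcon j⟩
      obtain ⟨l, hl⟩ := hex
      let A : Finset V :=
        Finset.univ.filter (fun a => (Sum.inl a : V ⊕ Fin (Fintype.card V + 1)) ∈ S)
      have hA : A.card ≤ (S.erase (Sum.inr l)).card :=
        Finset.card_le_card_of_injOn Sum.inl (fun a ha => by simpa [A] using ha)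
          (Sum.inl_injective.injOn)
      have hpos := Finset.card_pos.mpr ⟨_, hl⟩
      rw [Finset.card_erase_of_mem hl] at hA
      have hnl := hmin (A : Set V) (by rw [Set.ncard_coe_finset]; omega)
      unfold IsLocatingSet at hnl
      push Not at hnl
      obtain ⟨u, v, hu, hv, huv, he⟩ := hnl
      have hu' : (Sum.inl u : V ⊕ Fin (Fintype.card V + 1)) ∉ S := by simpa [A] using hu
      have hv' : (Sum.inl v : V ⊕ Fin (Fintype.card V + 1)) ∉ S := by simpa [A] using hv
      refine ⟨(Sum.inl u, Sum.inl v), Or.inl ⟨u, v, huv, rfl⟩, Or.inr (aa_inr_inl _ _),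
        Or.inr (aa_inr_inl _ _), answer_base i S hu' hv' ?_⟩
      intro a ha
      have haA : a ∈ (A : Set V) := by simpa [A] using ha
      have hau : a ≠ u := by rintro rfl; exact hu haA
      have hav : a ≠ v := by rintro rfl; exact hv haA
      have := Set.ext_iff.mp he a
      simp only [Set.mem_ofPred_eq] at this
      tauto

/-- Lower bound. -/
lemma not_win [Fintype V] [DecidableEq V] (v0 : V) (k : ℕ)
    (hkn : k < Fintype.card V)
    (hmin : ∀ L : Set V, L.ncard < k → ¬ IsLocatingSet G L) (m : ℕ) (hm : m ≤ k) :
    ¬ LocGameWin (addApexes G (Fintype.card V + 1)) m := by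
  rintro ⟨σ, hσ, hwin⟩
  have hstep := fun (h : List ((V ⊕ Fin (Fintype.card V + 1)) → Option ℕ))
    (p : {p : (V ⊕ Fin (Fintype.card V + 1)) × (V ⊕ Fin (Fintype.card V + 1)) // GoodPair p}) =>
    robber_step (G := G) v0 k hkn hmin (σ h) ((hσ h).trans hm) p.1 p.2
  choose f hgood hm1 hm2 hans using hstep
  have hcard : 0 < Fintype.card V := by omega
  let H := addApexes G (Fintype.card V + 1)
  let p0 : {p : (V ⊕ Fin (Fintype.card V + 1)) × (V ⊕ Fin (Fintype.card V + 1)) // GoodPair p} :=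
    ⟨(Sum.inr ⟨0, by omega⟩, Sum.inr ⟨1, by omega⟩),
      Or.inr ⟨⟨0, by omega⟩, ⟨1, by omega⟩, by simp, rfl⟩⟩
  let st : ℕ → List ((V ⊕ Fin (Fintype.card V + 1)) → Option ℕ) ×
      {p : (V ⊕ Fin (Fintype.card V + 1)) × (V ⊕ Fin (Fintype.card V + 1)) // GoodPair p} :=
    fun t => Nat.rec ([], p0) (fun _ s =>
      (s.1 ++ [probeAnswer H (σ s.1) (f s.1 s.2).1], ⟨f s.1 s.2, hgood s.1 s.2⟩)) t
  have hst : ∀ t, st (t + 1) = ((st t).1 ++ [probeAnswer H (σ (st t).1) (f (st t).1 (st t).2).1],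
      ⟨f (st t).1 (st t).2, hgood (st t).1 (st t).2⟩) := fun t => rfl
  let w : ℕ → V ⊕ Fin (Fintype.card V + 1) := fun t => (st (t + 1)).2.1.1
  let w' : ℕ → V ⊕ Fin (Fintype.card V + 1) := fun t => (st (t + 1)).2.1.2
  have hw : IsRobberWalk H w := fun t => hm1 (st (t + 1)).1 (st (t + 1)).2
  have hw' : IsRobberWalk H w' := fun t => hm2 (st (t + 1)).1 (st (t + 1)).2
  have hh : ∀ t, answerHistory H σ w t = (st t).1 := by
    intro t
    induction t with
    | zero => rfl
    | succ t ih => rw [answerHistory, ih, hst]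
  have hh' : ∀ t, answerHistory H σ w' t = (st t).1 := by
    intro t
    induction t with
    | zero => rfl
    | succ t ih =>
      rw [answerHistory, ih, hst]
      have := hans (st t).1 (st t).2
      exact congrArg (fun x => (st t).1 ++ [x]) this.symm
  obtain ⟨t, ht⟩ := hwin w hw
  have heq := ht w' hw' ((hh' (t + 1)).trans (hh (t + 1)).symm)
  have hne : ∀ p : {p : (V ⊕ Fin (Fintype.card V + 1)) × (V ⊕ Fin (Fintype.card V + 1)) //
      GoodPair p}, p.1.2 ≠ p.1.1 := by
    rintro ⟨p, ⟨u, v, huv, rfl⟩ | ⟨i, j, hij, rfl⟩⟩ h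
    · exact huv (Sum.inl.inj h).symm
    · exact hij (Sum.inr.inj h).symm
  exact hne _ heq

lemma length_answerHistory {W : Type*} [DecidableEq W] (H : SimpleGraph W)
    (σ : List (W → Option ℕ) → Finset W) (w : ℕ → W) (t : ℕ) :
    (answerHistory H σ w t).length = t := by
  induction t with
  | zero => rfl
  | succ t ih => simp [answerHistory, ih]

/-- Upper bound. -/
lemma win [Fintype V] [DecidableEq V] (v0 : V) (L : Finset V) (hL : IsLocatingSet G (L : Set V)) :
    LocGameWin (addApexes G (c + 1)) (L.card + 1) := by
  let S : ℕ → Finset (V ⊕ Fin (c + 1)) := fun t =>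
    insert (Sum.inr (Fin.ofNat (c + 1) t)) (L.image Sum.inl)
  let H := addApexes G (c + 1)
  refine ⟨fun h => S h.length, fun h => ?_, fun w hw => ?_⟩
  · exact (Finset.card_insert_le _ _).trans (Nat.add_le_add_right Finset.card_image_le 1)
  have key : ∀ w' t, answerHistory H (fun h => S h.length) w' (t + 1) =
      answerHistory H (fun h => S h.length) w (t + 1) →
      ∀ z ∈ S t, H.dist z (w' t) = H.dist z (w t) := by
    intro w' t he z hz
    rw [answerHistory, answerHistory] at he
    have h2 := List.append_inj_right' he rfl
    simp only [length_answerHistory] at h2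
    have h3 := congrFun (List.singleton_inj.mp h2) z
    simpa [probeAnswer, hz] using h3
  have hin : ∀ t, Sum.inr (Fin.ofNat (c + 1) t) ∈ S t := fun t => Finset.mem_insert_self _ _
  have hinL : ∀ t, ∀ a ∈ L, Sum.inl a ∈ S t := fun t a ha =>
    Finset.mem_insert_of_mem (Finset.mem_image_of_mem _ ha)
  by_cases hV : ∃ t u, w t = Sum.inl u
  · obtain ⟨t, u, hu⟩ := hV
    refine ⟨t, fun w' hw' he => ?_⟩
    have hk := key w' t he
    rw [hu] at hk ⊢
    rcases hwt : w' t with v | i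
    · rw [hwt] at hk
      congr 1
      by_contra hne
      have hr : ∀ a b : V, H.Reachable (Sum.inl a) (Sum.inl b) := fun a b =>
        (aa_inl_inr (c := c + 1) a 0).reachable.trans (aa_inr_inl b 0).reachable
      have hvL : v ∉ L := fun hv => by
        have := hk _ (hinL t v hv)
        rw [SimpleGraph.dist_self] at this
        exact hne (Sum.inl.inj ((hr _ _).dist_eq_zero_iff.mp this.symm))
      have huL : u ∉ L := fun hv => by
        have := hk _ (hinL t u hv)
        rw [SimpleGraph.dist_self] at this
        exact hne (Sum.inl.inj ((hr _ _).dist_eq_zero_iff.mp this)).symm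
      refine hL v u (by simpa using hvL) (by simpa using huL) hne ?_
      ext a
      simp only [Set.mem_ofPred_eq, Finset.mem_coe]
      refine and_congr_right fun ha => ?_
      have h1 : a ≠ v := by rintro rfl; exact hvL ha
      have h2 : a ≠ u := by rintro rfl; exact huL ha
      simp only [h1, h2, false_or]
      rw [← aa_inl_inl (c := c + 1) a v, ← aa_inl_inl (c := c + 1) a u,
        ← SimpleGraph.dist_eq_one_iff_adj, ← SimpleGraph.dist_eq_one_iff_adj]
      have := hk _ (hinL t a ha)
      change H.dist _ _ = 1 ↔ H.dist _ _ = 1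
      rw [this]
    · have := hk _ (hin t)
      rw [hwt] at this
      exfalso
      change (addApexes G (c + 1)).dist _ _ = (addApexes G (c + 1)).dist _ _ at this
      rw [dist_inr_inl] at this
      exact aa_inr_inr _ _ (SimpleGraph.dist_eq_one_iff_adj.mp this)
  · push Not at hV
    have hconst : ∀ t, w t = w 0 := by
      intro t
      induction t with
      | zero => rfl
      | succ t ih =>
        rcases hw t with h | h
        · rw [h, ih]
        · exfalso
          rcases h1 : w t with a | i
          · exact hV _ _ h1
          rcases h2 : w (t + 1) with a | j
          · exact hV _ _ h2
          rw [h1, h2] at h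
          exact aa_inr_inr _ _ h
    rcases h0 : w 0 with a | i
    · exact absurd h0 (hV _ _)
    refine ⟨i.val, fun w' hw' he => ?_⟩
    have := key w' i.val he _ (hin i.val)
    have hi : Fin.ofNat (c + 1) i.val = i := by ext; simp [Nat.mod_eq_of_lt]
    rw [hconst, h0] at this ⊢
    rw [hi, SimpleGraph.dist_self] at this
    have hr : ∀ z, H.Reachable (Sum.inr i) z := by
      rintro (a | j)
      · exact (aa_inr_inl a i).reachable
      · exact (aa_inr_inl v0 i).reachable.trans (aa_inl_inr v0 j).reachable
    exact ((hr _).dist_eq_zero_iff.mp this).symm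

end helpers

/-- Let `G` be a finite connected graph on `n` vertices with diameter `2` and let `k`
be the minimum size of a locating set of `G`.  Then the graph `G'` obtained from `G`
by adding `n + 1` pairwise non-adjacent vertices, each adjacent to every vertex of
`G`, satisfies `ζ(G') = k + 1`. -/
theorem locNumber_addApexes_eq_locating_min_add_one {V : Type*} [Fintype V]
    [DecidableEq V] (G : SimpleGraph V) (hconn : G.Connected)
    (hdiam_le : ∀ u v : V, G.dist u v ≤ 2) (hdiam_eq : ∃ u v : V, G.dist u v = 2)
    (k : ℕ) (hk : k = sInf {m | ∃ L : Set V, IsLocatingSet G L ∧ L.ncard = m}) :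
    locNumber (addApexes G (Fintype.card V + 1)) = k + 1 := by
  obtain ⟨v0⟩ := hconn.nonempty
  have hne : {m | ∃ L : Set V, IsLocatingSet G L ∧ L.ncard = m}.Nonempty :=
    ⟨_, Set.univ, fun u v hu => absurd (Set.mem_univ u) hu, rfl⟩
  obtain ⟨L, hL, hLk⟩ := Nat.sInf_mem hne
  rw [← hk] at hLk
  have hmin : ∀ L : Set V, L.ncard < k → ¬ IsLocatingSet G L := by
    intro L hlt hloc
    have : k ≤ L.ncard := hk ▸ Nat.sInf_le ⟨L, hloc, rfl⟩
    omega
  have hkn : k < Fintype.card V := by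
    by_contra hcon
    refine hmin ((Finset.univ.erase v0 : Finset V) : Set V) ?_ ?_
    · rw [Set.ncard_coe_finset, Finset.card_erase_of_mem (Finset.mem_univ _), Finset.card_univ]
      have : 0 < Fintype.card V := Fintype.card_pos_iff.mpr ⟨v0⟩
      omega
    · intro u v hu hv huv
      exfalso
      simp at hu hv
      exact huv (hu.trans hv.symm)
  have hwin : LocGameWin (addApexes G (Fintype.card V + 1)) (k + 1) := by
    classical
    have := win (c := Fintype.card V) v0 L.toFinset (by simpa using hL)
    rwa [← Set.ncard_eq_toFinset_card', hLk] at this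
  apply le_antisymm
  · exact Nat.sInf_le hwin
  · refine le_csInf ⟨_, hwin⟩ fun m hm => ?_
    by_contra hcon
    exact not_win v0 k hkn hmin m (by omega) hm
end
end

section
/- Every finite connected bipartite simple graph G with bipartition classes of sizes a and b satisfies ζ(G) ≤ min(a, b). -/
noncomputable section

open SimpleGraph

theorem probe_eq_dist {V : Type*} [DecidableEq V] {G : SimpleGraph V} {S : Finset V} {x y v : V}
    (h : probeAnswer G S x = probeAnswer G S y) (hv : v ∈ S) : G.dist v x = G.dist v y := by
  have := congrFun h v
  simpa [probeAnswer, hv] using this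

theorem probe_eq_of_mem {V : Type*} [DecidableEq V] {G : SimpleGraph V} (hG : G.Connected)
    {S : Finset V} {x y : V}
    (h : probeAnswer G S x = probeAnswer G S y) (hv : x ∈ S ∨ y ∈ S) : x = y := by
  rcases hv with hv | hv
  · have := probe_eq_dist h hv
    rw [SimpleGraph.dist_self] at this
    exact (hG.dist_eq_zero_iff).1 this.symm
  · have := probe_eq_dist h hv
    rw [SimpleGraph.dist_self] at this
    exact ((hG.dist_eq_zero_iff).1 this).symm

theorem hist_succ_eq {V : Type*} [DecidableEq V] {G : SimpleGraph V}
    {σ : List (V → Option ℕ) → Finset V} {w w' : ℕ → V} {t : ℕ}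
    (h : answerHistory G σ w' (t + 1) = answerHistory G σ w (t + 1)) :
    answerHistory G σ w' t = answerHistory G σ w t ∧
      probeAnswer G (σ (answerHistory G σ w t)) (w' t) =
        probeAnswer G (σ (answerHistory G σ w t)) (w t) := by
  simp only [answerHistory] at h
  obtain ⟨h1, h2⟩ := List.append_inj' h rfl
  refine ⟨h1, ?_⟩
  rw [h1] at h2
  simpa using h2

theorem hist_le_eq {V : Type*} [DecidableEq V] {G : SimpleGraph V}
    {σ : List (V → Option ℕ) → Finset V} {w w' : ℕ → V} {t : ℕ}
    (h : answerHistory G σ w' (t + 1) = answerHistory G σ w (t + 1)) :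
    ∀ i ≤ t, probeAnswer G (σ (answerHistory G σ w i)) (w' i) =
        probeAnswer G (σ (answerHistory G σ w i)) (w i) := by
  induction t with
  | zero =>
    intro i hi
    obtain rfl : i = 0 := by omega
    exact (hist_succ_eq h).2
  | succ n ih =>
    intro i hi
    rcases Nat.lt_or_ge n i with h' | h'
    · obtain rfl : i = n + 1 := by omega
      exact (hist_succ_eq h).2
    · exact ih (hist_succ_eq h).1 i h'

theorem hist_cons {V : Type*} [DecidableEq V] (G : SimpleGraph V)
    (σ : List (V → Option ℕ) → Finset V) (w : ℕ → V) (t : ℕ) :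
    ∃ rest, answerHistory G σ w (t + 1) = probeAnswer G (σ []) (w 0) :: rest ∧
      rest.length = t := by
  induction t with
  | zero => exact ⟨[], by simp [answerHistory], rfl⟩
  | succ n ih =>
    obtain ⟨r, h1, h2⟩ := ih
    rw [answerHistory, h1]
    exact ⟨_, List.cons_append, by simp [h2]⟩

theorem walk_parity {V : Type*} {G : SimpleGraph V} {A B : Finset V}
    (hcover : ∀ v : V, v ∈ A ∨ v ∈ B) (hdisj : Disjoint A B)
    (hbip : ∀ u v : V, G.Adj u v → (u ∈ A ↔ v ∈ B)) {u v : V} (p : G.Walk u v) :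
    (u ∈ B ↔ v ∈ B) ↔ Even p.length := by
  induction p with
  | nil => simp
  | @cons u v w h p ih =>
    rw [SimpleGraph.Walk.length_cons, Nat.even_add_one, ← ih]
    have h1 := hbip _ _ h
    have h2 := hcover u
    have h3 : u ∈ A → u ∉ B := fun h => Finset.disjoint_left.1 hdisj h
    tauto

theorem dist_parity {V : Type*} {G : SimpleGraph V} (hG : G.Connected) {A B : Finset V}
    (hcover : ∀ v : V, v ∈ A ∨ v ∈ B) (hdisj : Disjoint A B)
    (hbip : ∀ u v : V, G.Adj u v → (u ∈ A ↔ v ∈ B)) {u x y : V}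
    (h : G.dist u x = G.dist u y) : x ∈ B ↔ y ∈ B := by
  obtain ⟨p, hp⟩ := hG.exists_walk_length_eq_dist u x
  obtain ⟨q, hq⟩ := hG.exists_walk_length_eq_dist u y
  have h1 := walk_parity hcover hdisj hbip p
  have h2 := walk_parity hcover hdisj hbip q
  rw [hp, h, ← hq, ← h2] at h1
  tauto

theorem exists_probe_s9 {V : Type*} [Fintype V] [DecidableEq V]
    (G : SimpleGraph V) (A B : Finset V) (hA : A.Nonempty)
    (hdisj : Disjoint A B) (hcover : ∀ v : V, v ∈ A ∨ v ∈ B)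
    (hbip : ∀ u v : V, G.Adj u v → (u ∈ A ↔ v ∈ B)) (f : V → Option ℕ) :
    ∃ S : Finset V, S.card + 1 ≤ A.card ∧ ∀ v ∈ B, probeAnswer G A v = f →
      ∀ v' ∈ B, probeAnswer G A v' = f →
      ∀ x y, G.Adj v x → G.Adj v' y → x ∉ S → y ∉ S → x = y := by
  classical
  have hpos : 1 ≤ A.card := hA.card_pos
  by_cases hex : ∃ v ∈ B, probeAnswer G A v = f ∧ ∃ s, G.Adj v s
  · obtain ⟨v, hv, hf, s, hs⟩ := hex
    have key : ∀ v' ∈ B, probeAnswer G A v' = f → ∀ x, G.Adj v' x → x ∈ A ∧ G.Adj v x := by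
      intro v' hv' hf' x hx
      have hxA : x ∈ A := (hbip x v' hx.symm).2 hv'
      refine ⟨hxA, ?_⟩
      have h1 := probe_eq_dist (hf'.trans hf.symm) hxA
      rw [SimpleGraph.dist_eq_one_iff_adj.2 hx.symm] at h1
      exact (SimpleGraph.dist_eq_one_iff_adj.1 h1.symm).symm
    refine ⟨(A.filter (fun x => G.Adj v x)).erase s, ?_, ?_⟩
    · have hsm : s ∈ A.filter (fun x => G.Adj v x) :=
        Finset.mem_filter.2 ⟨(key v hv hf s hs).1, hs⟩
      rw [Finset.card_erase_add_one hsm]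
      exact Finset.card_filter_le _ _
    · have aux : ∀ v' ∈ B, probeAnswer G A v' = f → ∀ x, G.Adj v' x →
          x ∉ (A.filter (fun x => G.Adj v x)).erase s → x = s := by
        intro v' hv' hf' x hx hn
        by_contra hne
        exact hn (Finset.mem_erase.2 ⟨hne, Finset.mem_filter.2 (key v' hv' hf' x hx)⟩)
      intro v1 h1 hf1 v2 h2 hf2 x y hx hy hxn hyn
      rw [aux v1 h1 hf1 x hx hxn, aux v2 h2 hf2 y hy hyn]
  · refine ⟨∅, by simpa using hpos, ?_⟩
    intro v hv hf v' _ _ x y hx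
    exact absurd ⟨v, hv, hf, x, hx⟩ hex

theorem locGameWin_card {V : Type*} [Fintype V] [DecidableEq V]
    (G : SimpleGraph V) (hG : G.Connected) (A B : Finset V)
    (hcover : ∀ v : V, v ∈ A ∨ v ∈ B) (hdisj : Disjoint A B)
    (hbip : ∀ u v : V, G.Adj u v → (u ∈ A ↔ v ∈ B)) :
    LocGameWin G A.card := by
  rcases A.eq_empty_or_nonempty with hA | hA
  · refine ⟨fun _ => ∅, fun _ => by simp, fun w _ => ⟨0, fun w' _ _ => ?_⟩⟩
    obtain ⟨p⟩ := hG.preconnected (w' 0) (w 0)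
    generalize w' 0 = x at p ⊢
    generalize w 0 = y at p ⊢
    cases p with
    | nil => rfl
    | @cons _ v _ h q =>
      exfalso
      have h1 := hbip _ _ h
      have h2 := hcover v
      simp [hA] at h1 h2
      exact h1 h2
  choose S hS1 hS2 using exists_probe_s9 G A B hA hdisj hcover hbip
  have hg : ∃ g : ℕ → V, B.Nonempty → (∀ i, g i ∈ B) ∧ ∀ v ∈ B, ∃ i, g i = v := by
    by_cases hB : B.Nonempty
    · haveI : Nonempty B := hB.to_subtype
      obtain ⟨g, hg⟩ := exists_surjective_nat B
      refine ⟨fun i => g i, fun _ => ⟨fun i => (g i).2, fun v hv => ?_⟩⟩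
      obtain ⟨i, hi⟩ := hg ⟨v, hv⟩
      exact ⟨i, by simp [hi]⟩
    · exact ⟨fun _ => hA.choose, fun h => absurd h hB⟩
  obtain ⟨g, hg⟩ := hg
  let σ : List (V → Option ℕ) → Finset V := fun l => match l with
    | [] => A
    | f :: rest => insert (g rest.length) (S f)
  have hσ : ∀ w t, σ (answerHistory G σ w (t + 1)) =
      insert (g t) (S (probeAnswer G A (w 0))) := by
    intro w t
    obtain ⟨r, h1, h2⟩ := hist_cons G σ w t
    rw [h1, ← h2]
  refine ⟨σ, ?_, ?_⟩
  · intro h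
    cases h with
    | nil => exact le_rfl
    | cons f r => exact (Finset.card_insert_le _ _).trans (hS1 f)
  intro w hw
  rcases hcover (w 0) with h0 | h0
  · refine ⟨0, fun w' _ h => ?_⟩
    exact probe_eq_of_mem hG (hist_le_eq h 0 le_rfl) (Or.inr h0)
  obtain ⟨hgB, hgs⟩ := hg ⟨_, h0⟩
  have notBB : ∀ u v, G.Adj u v → u ∈ B → v ∉ B := fun u v h hu hv =>
    Finset.disjoint_left.1 hdisj ((hbip u v h).2 hv) hu
  by_cases hc : ∀ t, w t = w 0
  · obtain ⟨i, hi⟩ := hgs _ h0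
    refine ⟨i + 1, fun w' _ h => ?_⟩
    have h1 := hist_le_eq h (i + 1) le_rfl
    refine probe_eq_of_mem hG h1 (Or.inr ?_)
    rw [hσ, hc (i + 1), hi]
    exact Finset.mem_insert_self _ _
  classical
  have hc' : ∃ t, w t ≠ w 0 := by simpa using hc
  obtain ⟨t, ht, hmin⟩ : ∃ t, w (t + 1) ≠ w 0 ∧ ∀ i ≤ t, w i = w 0 := by
    have hsp := Nat.find_spec hc'
    cases hn : Nat.find hc' with
    | zero => rw [hn] at hsp; exact absurd rfl hsp
    | succ n =>
      rw [hn] at hsp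
      refine ⟨n, hsp, fun i hi => ?_⟩
      have := Nat.find_min hc' (m := i) (by omega)
      simpa using this
  refine ⟨t + 1, fun w' hw' h => ?_⟩
  have hall := hist_le_eq h
  have hf : probeAnswer G A (w' 0) = probeAnswer G A (w 0) := hall 0 (by omega)
  have hpar : ∀ i ≤ t, (w' (i + 1) ∈ B ↔ w (i + 1) ∈ B) := by
    intro i hi
    have h1 := hall (i + 1) (by omega)
    refine dist_parity hG hcover hdisj hbip (probe_eq_dist (v := g i) h1 ?_)
    rw [hσ]
    exact Finset.mem_insert_self _ _
  have h0' : w' 0 ∈ B := by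
    obtain ⟨x, hx⟩ := hA
    exact (dist_parity hG hcover hdisj hbip (probe_eq_dist hf hx)).2 h0
  have hconst : ∀ i ≤ t, w' i = w' 0 := by
    intro i
    induction i with
    | zero => intro _; rfl
    | succ n ih =>
      intro hi
      have h1 := ih (by omega)
      rcases hw' n with h2 | h2
      · rw [h2, h1]
      · exfalso
        refine notBB _ _ h2 (h1 ▸ h0') ((hpar n (by omega)).2 ?_)
        rw [hmin _ hi]
        exact h0
  have hadj : G.Adj (w 0) (w (t + 1)) := by
    rcases hw t with h2 | h2
    · exact absurd (h2.trans (hmin t le_rfl)) ht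
    · rwa [hmin t le_rfl] at h2
  have hadj' : G.Adj (w' 0) (w' (t + 1)) := by
    rcases hw' t with h2 | h2
    · exfalso
      refine notBB _ _ hadj h0 ((hpar t le_rfl).1 ?_)
      rw [h2, hconst t le_rfl]
      exact h0'
    · rwa [hconst t le_rfl] at h2
  have hlast := hall (t + 1) le_rfl
  rw [hσ] at hlast
  by_cases hin : w' (t + 1) ∈ S (probeAnswer G A (w 0)) ∨ w (t + 1) ∈ S (probeAnswer G A (w 0))
  · exact probe_eq_of_mem hG hlast
      (hin.imp Finset.mem_insert_of_mem Finset.mem_insert_of_mem)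
  · rw [not_or] at hin
    exact hS2 _ _ h0' hf _ h0 rfl _ _ hadj' hadj hin.1 hin.2

/-- Every finite connected bipartite graph with bipartition classes `A` and `B` of
sizes `a` and `b` satisfies `ζ(G) ≤ min (a, b)`. -/
theorem locNumber_le_min_of_bipartition {V : Type*} [Fintype V] [DecidableEq V]
    (G : SimpleGraph V) (hG : G.Connected) (A B : Finset V) (a b : ℕ)
    (ha : A.card = a) (hb : B.card = b)
    (hcover : ∀ v : V, v ∈ A ∨ v ∈ B) (hdisj : Disjoint A B)
    (hbip : ∀ u v : V, G.Adj u v → (u ∈ A ↔ v ∈ B)) :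
    locNumber G ≤ min a b := by
  subst ha hb
  refine le_min (Nat.sInf_le (locGameWin_card G hG A B hcover hdisj hbip))
    (Nat.sInf_le (locGameWin_card G hG B A (fun v => (hcover v).symm) hdisj.symm
      (fun u v h => (hbip v u h.symm).symm)))
end
end

section
/- Let G be the graph with vertex set {a, b, c, d, e, f} in which {a, b, c, d} induce a complete graph K_4, e is adjacent exactly to a and b, and f is adjacent exactly to b and c. Then ζ(G) = 2 while its subgraph K_4 on {a, b, c, d} satisfies ζ(K_4) = 3. In particular, the localization number ζ is not monotone under taking subgraphs. -/
noncomputable section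

open SimpleGraph

/-- The graph on vertices `a = 0, b = 1, c = 2, d = 3, e = 4, f = 5` in which
`{a, b, c, d}` induce a `K₄`, `e` is adjacent exactly to `a` and `b`, and `f` is
adjacent exactly to `b` and `c`. -/
def exampleGraph : SimpleGraph (Fin 6) :=
  SimpleGraph.fromRel (fun i j =>
    (i.val < 4 ∧ j.val < 4) ∨ (i = 4 ∧ (j = 0 ∨ j = 1)) ∨ (i = 5 ∧ (j = 1 ∨ j = 2)))

lemma locGameWin_of_resolving {V : Type*} [DecidableEq V] (G : SimpleGraph V) (S : Finset V)
    (k : ℕ) (hS : S.card ≤ k) (h : ∀ x y, (∀ v ∈ S, G.dist v x = G.dist v y) → x = y) :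
    LocGameWin G k := by
  refine ⟨fun _ => S, fun _ => hS, fun w _ => ⟨0, fun w' _ he => ?_⟩⟩
  simp only [answerHistory, List.nil_append, List.cons.injEq, and_true] at he
  refine h _ _ fun v hv => ?_
  have := congrFun he v
  simpa [probeAnswer, hv] using this

/-- The answer history produced by a robber who always answers with `x (probe)`. -/
def evasionHist {V : Type*} [DecidableEq V] (G : SimpleGraph V)
    (σ : List (V → Option ℕ) → Finset V) (x : Finset V → V) : ℕ → List (V → Option ℕ)
  | 0 => []
  | t + 1 => evasionHist G σ x t ++
      [probeAnswer G (σ (evasionHist G σ x t)) (x (σ (evasionHist G σ x t)))]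

lemma not_locGameWin_of_clique {V : Type*} [DecidableEq V] (G : SimpleGraph V) (K : Set V)
    (hK : ∀ x ∈ K, ∀ y ∈ K, y = x ∨ G.Adj x y) (k : ℕ)
    (h : ∀ S : Finset V, S.card ≤ k →
      ∃ x ∈ K, ∃ y ∈ K, x ≠ y ∧ ∀ v ∈ S, G.dist v x = G.dist v y) :
    ¬ LocGameWin G k := by
  rintro ⟨σ, hσ, hwin⟩
  have h' : ∀ S : Finset V, ∃ x y, S.card ≤ k →
      (x ∈ K ∧ y ∈ K ∧ x ≠ y ∧ ∀ v ∈ S, G.dist v x = G.dist v y) := by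
    intro S
    by_cases hS : S.card ≤ k
    · obtain ⟨x, hx, y, hy, hxy⟩ := h S hS
      exact ⟨x, y, fun _ => ⟨hx, hy, hxy⟩⟩
    · obtain ⟨x, -⟩ := h ∅ (by simp)
      exact ⟨x, x, fun hh => absurd hh hS⟩
  choose x y hxy using h'
  let H := evasionHist G σ x
  let w : ℕ → V := fun t => x (σ (H t))
  have hwK : ∀ t, w t ∈ K := fun t => (hxy _ (hσ _)).1
  have hH : ∀ t, answerHistory G σ w t = H t := by
    intro t
    induction t with
    | zero => rfl
    | succ t ih => rw [answerHistory, ih]; rfl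
  obtain ⟨t, ht⟩ := hwin w fun t => hK _ (hwK _) _ (hwK _)
  obtain ⟨-, hyK, hne, hd⟩ := hxy _ (hσ (H t))
  let w' : ℕ → V := fun s => if s < t then w s else y (σ (H t))
  have hw'K : ∀ s, w' s ∈ K := by
    intro s
    by_cases hs : s < t
    · simp only [w', hs, if_true]; exact hwK s
    · simp only [w', hs, if_false]; exact hyK
  have hw't : w' t = y (σ (H t)) := by simp [w']
  have hist : ∀ s ≤ t, answerHistory G σ w' s = H s := by
    intro s
    induction s with
    | zero => intro _; rfl
    | succ s ih =>
      intro hs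
      have hs' : w' s = w s := by simp [w', Nat.lt_of_succ_le hs]
      rw [answerHistory, ih (by omega), hs']; rfl
  have := ht w' (fun s => hK _ (hw'K _) _ (hw'K _)) (by
    rw [answerHistory, answerHistory, hist t le_rfl, hH t, hw't]
    congr 2
    funext v
    by_cases hv : v ∈ σ (H t)
    · simp only [probeAnswer, hv, if_true]; rw [← hd v hv]
    · simp [probeAnswer, hv])
  rw [hw't] at this
  exact hne this.symm

instance exampleGraph_decidableAdj : DecidableRel exampleGraph.Adj := fun i j =>
  decidable_of_iff _ (SimpleGraph.fromRel_adj _ i j).symm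

lemma exampleGraph_dist (u v : Fin 6) :
    exampleGraph.dist u v = if u = v then 0 else if exampleGraph.Adj u v then 1 else 2 := by
  have hb : ∀ z : Fin 6, z = 1 ∨ exampleGraph.Adj z 1 := by decide
  split_ifs with h1 h2
  · subst h1; simp
  · exact SimpleGraph.dist_eq_one_iff_adj.2 h2
  · have hu : exampleGraph.Adj u 1 := (hb u).resolve_left (by
      rintro rfl; exact h2 ((hb v).resolve_left (fun h => h1 h.symm)).symm)
    have hv : exampleGraph.Adj v 1 := (hb v).resolve_left (by
      rintro rfl; exact h2 hu)
    let p : exampleGraph.Walk u v := .cons hu (.cons hv.symm .nil)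
    have hle : exampleGraph.dist u v ≤ 2 := SimpleGraph.dist_le p
    have h0 : exampleGraph.dist u v ≠ 0 := fun h => h1 (p.reachable.dist_eq_zero_iff.1 h)
    have h1' : exampleGraph.dist u v ≠ 1 := fun h => h2 (SimpleGraph.dist_eq_one_iff_adj.1 h)
    omega

lemma locNumber_eq {V : Type*} [DecidableEq V] (G : SimpleGraph V) (k : ℕ)
    (h : LocGameWin G (k + 1)) (h' : ¬ LocGameWin G k) : locNumber G = k + 1 := by
  apply le_antisymm (Nat.sInf_le h)
  by_contra! hlt
  change locNumber G < k + 1 at hlt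
  obtain ⟨σ, hσ, hw⟩ : LocGameWin G (locNumber G) := Nat.sInf_mem (s := {k | LocGameWin G k}) ⟨_, h⟩
  exact h' ⟨σ, fun l => (hσ l).trans (by omega), hw⟩

theorem locNumber_not_subgraph_monotone :
    locNumber exampleGraph = 2 ∧
    locNumber (completeGraph (Fin 4)) = 3 ∧
    Nonempty (completeGraph (Fin 4) ↪g exampleGraph) := by
  refine ⟨?_, ?_, ?_⟩
  · apply locNumber_eq
    · apply locGameWin_of_resolving _ {4, 5} _ (by decide)
      simp only [exampleGraph_dist]
      decide
    · apply not_locGameWin_of_clique _ {x | x.val < 4}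
      · simp only [Set.mem_ofPred_eq]
        decide
      · intro S hS
        obtain ⟨p, hp⟩ := Finset.card_le_one_iff_subset_singleton.1 hS
        have key : ∀ p : Fin 6, ∃ x : Fin 6, x.val < 4 ∧ ∃ y : Fin 6, y.val < 4 ∧ x ≠ y ∧
            exampleGraph.dist p x = exampleGraph.dist p y := by
          simp only [exampleGraph_dist]
          decide
        obtain ⟨x, hx, y, hy, hxy, hd⟩ := key p
        refine ⟨x, hx, y, hy, hxy, fun v hv => ?_⟩
        rw [Finset.mem_singleton.1 (hp hv)]
        exact hd
  · have hd : ∀ u v : Fin 4, (completeGraph (Fin 4)).dist u v = if u = v then 0 else 1 := by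
      intro u v
      split_ifs with h
      · subst h; simp
      · exact SimpleGraph.dist_eq_one_iff_adj.2 h
    apply locNumber_eq
    · apply locGameWin_of_resolving _ {0, 1, 2} _ (by decide)
      simp only [hd]
      decide
    · apply not_locGameWin_of_clique _ Set.univ
      · intro x _ y _
        by_cases h : y = x
        · exact Or.inl h
        · exact Or.inr (fun h' => h h'.symm)
      · intro S hS
        have hc : 1 < Sᶜ.card := by rw [Finset.card_compl, Fintype.card_fin]; omega
        obtain ⟨x, hx, y, hy, hxy⟩ := Finset.one_lt_card.1 hc
        rw [Finset.mem_compl] at hx hy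
        refine ⟨x, trivial, y, trivial, hxy, fun v hv => ?_⟩
        rw [hd, hd, if_neg (by rintro rfl; exact hx hv), if_neg (by rintro rfl; exact hy hv)]
  · refine ⟨⟨⟨fun i => Fin.castLE (by omega) i, Fin.castLE_injective (by omega)⟩, ?_⟩⟩
    intro a b
    change exampleGraph.Adj (Fin.castLE (by omega) a) (Fin.castLE (by omega) b) ↔ a ≠ b
    revert a b
    decide
end
end

section
/- Let G be a finite simple graph with at least two vertices, and let G' be obtained from G by adding three new vertices u, v, w, where u is adjacent to every vertex of V(G) ∪ {v, w}, v and w are adjacent to each other (and v, w have no other neighbors). Then the minimum size of a locating set of G' equals the minimum size of a locating set of G plus one. -/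
noncomputable section

open SimpleGraph

/-- The graph obtained from `G` by adding three new vertices `u = inr 0`, `v = inr 1`,
`w = inr 2`, where `u` is adjacent to every vertex of `V(G) ∪ {v, w}`, the vertices
`v` and `w` are adjacent to each other, and `v, w` have no other neighbors. -/
def addUVW {V : Type*} (G : SimpleGraph V) : SimpleGraph (V ⊕ Fin 3) :=
  SimpleGraph.fromRel (fun x y =>
    (∃ a b, x = Sum.inl a ∧ y = Sum.inl b ∧ G.Adj a b) ∨
    (x = Sum.inr 0 ∧ y ≠ Sum.inr 0) ∨
    (x = Sum.inr 1 ∧ y = Sum.inr 2))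

theorem addUVW_ll {V : Type*} (G : SimpleGraph V) (a b : V) :
    (addUVW G).Adj (Sum.inl a) (Sum.inl b) ↔ G.Adj a b := by
  simp only [addUVW, SimpleGraph.fromRel_adj]
  constructor
  · rintro ⟨-, h⟩
    simp at h
    rcases h with h | h
    · exact h
    · exact h.symm
  · intro h
    refine ⟨fun e => h.ne (Sum.inl.inj e), Or.inl (Or.inl ⟨a, b, rfl, rfl, h⟩)⟩

theorem addUVW_lr {V : Type*} (G : SimpleGraph V) (a : V) (i : Fin 3) :
    (addUVW G).Adj (Sum.inl a) (Sum.inr i) ↔ i = 0 := by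
  simp [addUVW, SimpleGraph.fromRel_adj]

theorem addUVW_rl {V : Type*} (G : SimpleGraph V) (a : V) (i : Fin 3) :
    (addUVW G).Adj (Sum.inr i) (Sum.inl a) ↔ i = 0 := by
  simp [addUVW, SimpleGraph.fromRel_adj]

theorem addUVW_rr {V : Type*} (G : SimpleGraph V) (i j : Fin 3) :
    (addUVW G).Adj (Sum.inr i) (Sum.inr j) ↔ i ≠ j := by
  fin_cases i <;> fin_cases j <;> simp [addUVW, SimpleGraph.fromRel_adj]

theorem locating_upper {V : Type*} [Fintype V] (G : SimpleGraph V)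
    (hV : 2 ≤ Fintype.card V) (L : Set V) (hL : IsLocatingSet G L) :
    IsLocatingSet (addUVW G) (insert (Sum.inr 1) (Sum.inl '' L)) := by
  have hne : ∃ z, z ∈ L := by
    by_contra hc
    push Not at hc
    obtain ⟨a, b, hab⟩ := Fintype.exists_pair_of_one_lt_card (α := V) (by omega)
    apply hL a b (hc a) (hc b) hab
    ext x
    simp [hc x]
  obtain ⟨z, hz⟩ := hne
  intro p q hp hq hpq he
  have h1 := Set.ext_iff.1 he (Sum.inr 1)
  have h2 := fun x => Set.ext_iff.1 he (Sum.inl x)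
  have h3 := h2 z
  rcases p with a | i <;> rcases q with b | j
  · simp at hp hq hpq
    apply hL a b hp hq hpq
    ext x
    have := h2 x
    simp [addUVW_ll] at this ⊢
    tauto
  · simp [addUVW_rl, addUVW_rr] at h1 hq
  · simp [addUVW_rl, addUVW_rr] at h1 hp
  · simp [addUVW_lr, hz] at h3 hp hq hpq
    omega

theorem locating_lower {V : Type*} [Fintype V] (G : SimpleGraph V)
    (L : Set (V ⊕ Fin 3)) (hL : IsLocatingSet (addUVW G) L) :
    IsLocatingSet G (Sum.inl ⁻¹' L) ∧ (Sum.inl ⁻¹' L : Set V).ncard + 1 ≤ L.ncard := by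
  constructor
  · intro a b ha hb hab he
    apply hL (Sum.inl a) (Sum.inl b) ha hb (by simpa using hab)
    ext x
    rcases x with x | i
    · have := Set.ext_iff.1 he x
      simp [addUVW_ll] at this ⊢
      tauto
    · simp [addUVW_rl]
  · have : ∃ i : Fin 3, Sum.inr i ∈ L := by
      by_contra hc
      push Not at hc
      apply hL (Sum.inr 1) (Sum.inr 2) (hc 1) (hc 2) (by simp)
      ext x
      rcases x with x | i
      · simp [addUVW_lr]
      · simp [hc i]
    obtain ⟨i, hi⟩ := this
    rw [← Set.ncard_image_of_injective (Sum.inl ⁻¹' L) (Sum.inl_injective (β := Fin 3)),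
      ← Set.ncard_insert_of_notMem (a := Sum.inr i) (by simp) (Set.toFinite _)]
    apply Set.ncard_le_ncard _ (Set.toFinite _)
    rintro x (rfl | ⟨y, hy, rfl⟩)
    · exact hi
    · exact hy

/-- For a finite graph `G` with at least two vertices, the minimum size of a locating
set of the graph `G'` described above equals the minimum size of a locating set of
`G` plus one. -/
theorem locating_min_addUVW {V : Type*} [Fintype V] (G : SimpleGraph V)
    (hV : 2 ≤ Fintype.card V) :
    sInf {m | ∃ L : Set (V ⊕ Fin 3), IsLocatingSet (addUVW G) L ∧ L.ncard = m} =
      sInf {m | ∃ L : Set V, IsLocatingSet G L ∧ L.ncard = m} + 1 := by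
  apply le_antisymm
  · obtain ⟨L, hL, hm⟩ : sInf {m | ∃ L : Set V, IsLocatingSet G L ∧ L.ncard = m} ∈
        {m | ∃ L : Set V, IsLocatingSet G L ∧ L.ncard = m} :=
      Nat.sInf_mem ⟨_, Set.univ, fun a b ha => absurd (Set.mem_univ a) ha, rfl⟩
    rw [← hm]
    apply Nat.sInf_le
    refine ⟨_, locating_upper G hV L hL, ?_⟩
    rw [Set.ncard_insert_of_notMem (by simp) (Set.toFinite _),
      Set.ncard_image_of_injective _ Sum.inl_injective]
  · obtain ⟨L, hL, hm⟩ : sInf {m | ∃ L : Set (V ⊕ Fin 3), IsLocatingSet (addUVW G) L ∧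
          L.ncard = m} ∈
        {m | ∃ L : Set (V ⊕ Fin 3), IsLocatingSet (addUVW G) L ∧ L.ncard = m} :=
      Nat.sInf_mem ⟨_, Set.univ, fun a b ha => absurd (Set.mem_univ a) ha, rfl⟩
    rw [← hm]
    obtain ⟨h1, h2⟩ := locating_lower G L hL
    refine le_trans (Nat.succ_le_succ (Nat.sInf_le ⟨_, h1, rfl⟩)) h2
end
end
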